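/- Let R be a polarized rewrite system in a language L, let L' be the language obtained by adding an equality symbol in each sort of L, and let Eq be the axioms of equality for L'. Then the theory ⟨R, Eq⟩ is a conservative extension of R: a sequent Γ ⊢ Δ of the language L is provable modulo R if and only if it is provable in Eq modulo R. -/

import Mathlib

namespace PDM

open Classical

noncomputable section

/-- A many-sorted first-order language. -/
structure Language : Type 1 where
  Sorts : Type
  Func : Type
  arity : Func → List Sorts
  ret : Func → Sorts
  Pred : Type
  parity : Pred → List Sorts

variable {L : Language}

/-- Well-sorted terms, with (per-sort de Bruijn style) variables. -/
inductive Term (L : Language) : L.Sorts → Type where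
  | var {s : L.Sorts} (n : ℕ) : Term L s
  | func (f : L.Func)
      (args : (i : Fin (L.arity f).length) → Term L ((L.arity f).get i)) :
      Term L (L.ret f)

def Term.rename (ρ : (s : L.Sorts) → ℕ → ℕ) :
    (s : L.Sorts) → Term L s → Term L s
  | s, .var n => .var (ρ s n)
  | _, .func f args => .func f fun i => Term.rename ρ _ (args i)

def Term.subst (σ : (s : L.Sorts) → ℕ → Term L s) :
    (s : L.Sorts) → Term L s → Term L s
  | s, .var n => σ s n
  | _, .func f args => .func f fun i => Term.subst σ _ (args i)

/-- Shift up the variables of sort `s₀`. -/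
def shiftRen (s₀ : L.Sorts) : (s : L.Sorts) → ℕ → ℕ :=
  fun s n => if s = s₀ then n + 1 else n

/-- Push a renaming under a binder of sort `s₀`. -/
def liftRen (s₀ : L.Sorts) (ρ : (s : L.Sorts) → ℕ → ℕ) : (s : L.Sorts) → ℕ → ℕ :=
  fun s n =>
    if s = s₀ then
      match n with
      | 0 => 0
      | n + 1 => ρ s n + 1
    else ρ s n

/-- Push a substitution under a binder of sort `s₀`. -/
def liftSubst (s₀ : L.Sorts) (σ : (s : L.Sorts) → ℕ → Term L s) :
    (s : L.Sorts) → ℕ → Term L s :=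
  fun s n =>
    if s = s₀ then
      match n with
      | 0 => .var 0
      | n + 1 => Term.rename (shiftRen s₀) s (σ s n)
    else Term.rename (shiftRen s₀) s (σ s n)

/-- First-order propositions over `L`. -/
inductive Form (L : Language) : Type where
  | pred (p : L.Pred)
      (args : (i : Fin (L.parity p).length) → Term L ((L.parity p).get i)) : Form L
  | bot : Form L
  | top : Form L
  | not (A : Form L) : Form L
  | and (A B : Form L) : Form L
  | or (A B : Form L) : Form L
  | imp (A B : Form L) : Form L
  | all (s : L.Sorts) (A : Form L) : Form L
  | ex (s : L.Sorts) (A : Form L) : Form L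

def Form.rename : ((s : L.Sorts) → ℕ → ℕ) → Form L → Form L
  | ρ, .pred p args => .pred p fun i => Term.rename ρ _ (args i)
  | _, .bot => .bot
  | _, .top => .top
  | ρ, .not A => .not (Form.rename ρ A)
  | ρ, .and A B => .and (Form.rename ρ A) (Form.rename ρ B)
  | ρ, .or A B => .or (Form.rename ρ A) (Form.rename ρ B)
  | ρ, .imp A B => .imp (Form.rename ρ A) (Form.rename ρ B)
  | ρ, .all s A => .all s (Form.rename (liftRen s ρ) A)
  | ρ, .ex s A => .ex s (Form.rename (liftRen s ρ) A)

def Form.subst : ((s : L.Sorts) → ℕ → Term L s) → Form L → Form L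
  | σ, .pred p args => .pred p fun i => Term.subst σ _ (args i)
  | _, .bot => .bot
  | _, .top => .top
  | σ, .not A => .not (Form.subst σ A)
  | σ, .and A B => .and (Form.subst σ A) (Form.subst σ B)
  | σ, .or A B => .or (Form.subst σ A) (Form.subst σ B)
  | σ, .imp A B => .imp (Form.subst σ A) (Form.subst σ B)
  | σ, .all s A => .all s (Form.subst (liftSubst s σ) A)
  | σ, .ex s A => .ex s (Form.subst (liftSubst s σ) A)

/-- Shift up the free variables of sort `s₀` in a proposition. -/
def Form.shift (s₀ : L.Sorts) (A : Form L) : Form L :=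
  Form.rename (shiftRen s₀) A

/-- The substitution replacing the free variable `0` of sort `s` by `t`
(and shifting the other variables of sort `s` down). -/
def subst0 {s : L.Sorts} (t : Term L s) : (s' : L.Sorts) → ℕ → Term L s' :=
  fun s' n =>
    if h : s = s' then
      match n with
      | 0 => h ▸ t
      | n + 1 => .var n
    else .var n

/-- Instantiation of the body of a quantifier over sort `s` with a term `t`. -/
def Form.inst {s : L.Sorts} (t : Term L s) (A : Form L) : Form L :=
  Form.subst (subst0 t) A

def Form.IsAtomic : Form L → Prop
  | .pred _ _ => True
  | _ => False

/-- A polarized rewrite system: equations between terms, and negative and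
positive proposition rewrite rules whose left-hand sides are atomic. -/
structure PRS (L : Language) : Type 1 where
  eqns : (s : L.Sorts) → Term L s → Term L s → Prop
  neg : Form L → Form L → Prop
  pos : Form L → Form L → Prop
  neg_atomic : ∀ {P A : Form L}, neg P A → P.IsAtomic
  pos_atomic : ∀ {P A : Form L}, pos P A → P.IsAtomic

/-- The congruence on terms generated by the equations. -/
inductive EqE (rs : PRS L) : (s : L.Sorts) → Term L s → Term L s → Prop where
  | base {s : L.Sorts} {t u : Term L s} (σ : (s : L.Sorts) → ℕ → Term L s) :
      rs.eqns s t u → EqE rs s (Term.subst σ s t) (Term.subst σ s u)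
  | refl {s : L.Sorts} (t : Term L s) : EqE rs s t t
  | symm {s : L.Sorts} {t u : Term L s} : EqE rs s t u → EqE rs s u t
  | trans {s : L.Sorts} {t u v : Term L s} :
      EqE rs s t u → EqE rs s u v → EqE rs s t v
  | congr (f : L.Func)
      {args args' : (i : Fin (L.arity f).length) → Term L ((L.arity f).get i)}
      (h : ∀ i, EqE rs _ (args i) (args' i)) :
      EqE rs (L.ret f) (.func f args) (.func f args')

mutual
  /-- One step negative rewriting. -/
  inductive RwNeg (rs : PRS L) : Form L → Form L → Prop where
    | predArg (p : L.Pred)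
        (args args' : (i : Fin (L.parity p).length) → Term L ((L.parity p).get i))
        (i : Fin (L.parity p).length) :
        EqE rs _ (args i) (args' i) → (∀ j, j ≠ i → args j = args' j) →
        RwNeg rs (.pred p args) (.pred p args')
    | rule {P A : Form L} (σ : (s : L.Sorts) → ℕ → Term L s) :
        rs.neg P A → RwNeg rs (Form.subst σ P) (Form.subst σ A)
    | notC {A A' : Form L} : RwPos rs A A' → RwNeg rs (.not A) (.not A')
    | andL {A A' B : Form L} : RwNeg rs A A' → RwNeg rs (.and A B) (.and A' B)
    | andR {A B B' : Form L} : RwNeg rs B B' → RwNeg rs (.and A B) (.and A B')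
    | orL {A A' B : Form L} : RwNeg rs A A' → RwNeg rs (.or A B) (.or A' B)
    | orR {A B B' : Form L} : RwNeg rs B B' → RwNeg rs (.or A B) (.or A B')
    | impL {A A' B : Form L} : RwPos rs A A' → RwNeg rs (.imp A B) (.imp A' B)
    | impR {A B B' : Form L} : RwNeg rs B B' → RwNeg rs (.imp A B) (.imp A B')
    | allC {s : L.Sorts} {A A' : Form L} :
        RwNeg rs A A' → RwNeg rs (.all s A) (.all s A')
    | exC {s : L.Sorts} {A A' : Form L} :
        RwNeg rs A A' → RwNeg rs (.ex s A) (.ex s A')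
  /-- One step positive rewriting. -/
  inductive RwPos (rs : PRS L) : Form L → Form L → Prop where
    | predArg (p : L.Pred)
        (args args' : (i : Fin (L.parity p).length) → Term L ((L.parity p).get i))
        (i : Fin (L.parity p).length) :
        EqE rs _ (args i) (args' i) → (∀ j, j ≠ i → args j = args' j) →
        RwPos rs (.pred p args) (.pred p args')
    | rule {P A : Form L} (σ : (s : L.Sorts) → ℕ → Term L s) :
        rs.pos P A → RwPos rs (Form.subst σ P) (Form.subst σ A)
    | notC {A A' : Form L} : RwNeg rs A A' → RwPos rs (.not A) (.not A')
    | andL {A A' B : Form L} : RwPos rs A A' → RwPos rs (.and A B) (.and A' B)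
    | andR {A B B' : Form L} : RwPos rs B B' → RwPos rs (.and A B) (.and A B')
    | orL {A A' B : Form L} : RwPos rs A A' → RwPos rs (.or A B) (.or A' B)
    | orR {A B B' : Form L} : RwPos rs B B' → RwPos rs (.or A B) (.or A B')
    | impL {A A' B : Form L} : RwNeg rs A A' → RwPos rs (.imp A B) (.imp A' B)
    | impR {A B B' : Form L} : RwPos rs B B' → RwPos rs (.imp A B) (.imp A B')
    | allC {s : L.Sorts} {A A' : Form L} :
        RwPos rs A A' → RwPos rs (.all s A) (.all s A')
    | exC {s : L.Sorts} {A A' : Form L} :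
        RwPos rs A A' → RwPos rs (.ex s A) (.ex s A')
end

/-- Reflexive-transitive closure of negative rewriting: `A →₋* B`. -/
def RwNegS (rs : PRS L) : Form L → Form L → Prop := Relation.ReflTransGen (RwNeg rs)

/-- Reflexive-transitive closure of positive rewriting: `A →₊* B`. -/
def RwPosS (rs : PRS L) : Form L → Form L → Prop := Relation.ReflTransGen (RwPos rs)

/-- One step rewriting of sequents. -/
inductive SeqRw (rs : PRS L) :
    Multiset (Form L) × Multiset (Form L) → Multiset (Form L) × Multiset (Form L) →
    Prop where
  | left {Γ Δ : Multiset (Form L)} {A A' : Form L} :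
      RwNeg rs A A' → SeqRw rs (A ::ₘ Γ, Δ) (A' ::ₘ Γ, Δ)
  | right {Γ Δ : Multiset (Form L)} {A A' : Form L} :
      RwPos rs A A' → SeqRw rs (Γ, A ::ₘ Δ) (Γ, A' ::ₘ Δ)
/-- Polarized sequent calculus modulo `rs`.  `Pf rs useCut n Γ Δ` means that the
sequent `Γ ⊢ Δ` has a proof of size `n`, using the cut rule only if
`useCut = true`. -/
inductive Pf (rs : PRS L) (useCut : Bool) :
    ℕ → Multiset (Form L) → Multiset (Form L) → Prop where
  | ax {A B P : Form L} :
      Form.IsAtomic P → RwNegS rs A P → RwPosS rs B P →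
      Pf rs useCut 1 {A} {B}
  | cut {Γ Δ : Multiset (Form L)} {A B C : Form L} {n m : ℕ} :
      useCut = true → RwNegS rs A B → RwPosS rs A C →
      Pf rs useCut n (B ::ₘ Γ) Δ → Pf rs useCut m Γ (C ::ₘ Δ) →
      Pf rs useCut (n + m + 1) Γ Δ
  | contrL {Γ Δ : Multiset (Form L)} {A B C : Form L} {n : ℕ} :
      RwNegS rs A B → RwNegS rs A C →
      Pf rs useCut n (B ::ₘ C ::ₘ Γ) Δ → Pf rs useCut (n + 1) (A ::ₘ Γ) Δ
  | contrR {Γ Δ : Multiset (Form L)} {A B C : Form L} {n : ℕ} :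
      RwPosS rs A B → RwPosS rs A C →
      Pf rs useCut n Γ (B ::ₘ C ::ₘ Δ) → Pf rs useCut (n + 1) Γ (A ::ₘ Δ)
  | weakL {Γ Δ : Multiset (Form L)} {A : Form L} {n : ℕ} :
      Pf rs useCut n Γ Δ → Pf rs useCut (n + 1) (A ::ₘ Γ) Δ
  | weakR {Γ Δ : Multiset (Form L)} {A : Form L} {n : ℕ} :
      Pf rs useCut n Γ Δ → Pf rs useCut (n + 1) Γ (A ::ₘ Δ)
  | topR {Γ Δ : Multiset (Form L)} {A : Form L} :
      RwPosS rs A .top → Pf rs useCut 1 Γ (A ::ₘ Δ)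
  | botL {Γ Δ : Multiset (Form L)} {A : Form L} :
      RwNegS rs A .bot → Pf rs useCut 1 (A ::ₘ Γ) Δ
  | notL {Γ Δ : Multiset (Form L)} {A B : Form L} {n : ℕ} :
      RwNegS rs A (.not B) →
      Pf rs useCut n Γ (B ::ₘ Δ) → Pf rs useCut (n + 1) (A ::ₘ Γ) Δ
  | notR {Γ Δ : Multiset (Form L)} {A B : Form L} {n : ℕ} :
      RwPosS rs A (.not B) →
      Pf rs useCut n (B ::ₘ Γ) Δ → Pf rs useCut (n + 1) Γ (A ::ₘ Δ)
  | andL {Γ Δ : Multiset (Form L)} {A B C : Form L} {n : ℕ} :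
      RwNegS rs A (.and B C) →
      Pf rs useCut n (B ::ₘ C ::ₘ Γ) Δ → Pf rs useCut (n + 1) (A ::ₘ Γ) Δ
  | andR {Γ Δ : Multiset (Form L)} {A B C : Form L} {n m : ℕ} :
      RwPosS rs A (.and B C) →
      Pf rs useCut n Γ (B ::ₘ Δ) → Pf rs useCut m Γ (C ::ₘ Δ) →
      Pf rs useCut (n + m + 1) Γ (A ::ₘ Δ)
  | orL {Γ Δ : Multiset (Form L)} {A B C : Form L} {n m : ℕ} :
      RwNegS rs A (.or B C) →
      Pf rs useCut n (B ::ₘ Γ) Δ → Pf rs useCut m (C ::ₘ Γ) Δ →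
      Pf rs useCut (n + m + 1) (A ::ₘ Γ) Δ
  | orR {Γ Δ : Multiset (Form L)} {A B C : Form L} {n : ℕ} :
      RwPosS rs A (.or B C) →
      Pf rs useCut n Γ (B ::ₘ C ::ₘ Δ) → Pf rs useCut (n + 1) Γ (A ::ₘ Δ)
  | impL {Γ Δ : Multiset (Form L)} {A B C : Form L} {n m : ℕ} :
      RwNegS rs A (.imp B C) →
      Pf rs useCut n Γ (B ::ₘ Δ) → Pf rs useCut m (C ::ₘ Γ) Δ →
      Pf rs useCut (n + m + 1) (A ::ₘ Γ) Δ
  | impR {Γ Δ : Multiset (Form L)} {A B C : Form L} {n : ℕ} :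
      RwPosS rs A (.imp B C) →
      Pf rs useCut n (B ::ₘ Γ) (C ::ₘ Δ) → Pf rs useCut (n + 1) Γ (A ::ₘ Δ)
  | allL {Γ Δ : Multiset (Form L)} {s : L.Sorts} {t : Term L s} {A B C : Form L}
      {n : ℕ} :
      RwNegS rs A (.all s B) → RwNegS rs (Form.inst t B) C →
      Pf rs useCut n (C ::ₘ Γ) Δ → Pf rs useCut (n + 1) (A ::ₘ Γ) Δ
  | allR {Γ Δ : Multiset (Form L)} {s : L.Sorts} {A B : Form L} {n : ℕ} :
      RwPosS rs A (.all s B) →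
      Pf rs useCut n (Γ.map (Form.shift s)) (B ::ₘ Δ.map (Form.shift s)) →
      Pf rs useCut (n + 1) Γ (A ::ₘ Δ)
  | exL {Γ Δ : Multiset (Form L)} {s : L.Sorts} {A B : Form L} {n : ℕ} :
      RwNegS rs A (.ex s B) →
      Pf rs useCut n (B ::ₘ Γ.map (Form.shift s)) (Δ.map (Form.shift s)) →
      Pf rs useCut (n + 1) (A ::ₘ Γ) Δ
  | exR {Γ Δ : Multiset (Form L)} {s : L.Sorts} {t : Term L s} {A B C : Form L}
      {n : ℕ} :
      RwPosS rs A (.ex s B) → RwPosS rs (Form.inst t B) C →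
      Pf rs useCut n Γ (C ::ₘ Δ) → Pf rs useCut (n + 1) Γ (A ::ₘ Δ)

/-- The sequent `Γ ⊢ Δ` is provable modulo `rs`. -/
def Provable (rs : PRS L) (Γ Δ : Multiset (Form L)) : Prop :=
  ∃ n, Pf rs true n Γ Δ

/-- The sequent `Γ ⊢ Δ` has a cut free proof modulo `rs`. -/
def CutFreeProvable (rs : PRS L) (Γ Δ : Multiset (Form L)) : Prop :=
  ∃ n, Pf rs false n Γ Δ

/-- The sequent `Γ ⊢ Δ` is provable in the set of axioms `T` modulo `rs`:
some finite multiset of axioms of `T` can be added on the left. -/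
def ProvableIn (rs : PRS L) (T : Set (Form L)) (Γ Δ : Multiset (Form L)) : Prop :=
  ∃ T' : Multiset (Form L), (∀ A ∈ T', A ∈ T) ∧ Provable rs (Γ + T') Δ

/-- The empty rewrite system; provability modulo it is ordinary provability in
classical first-order predicate logic. -/
def emptyPRS (L : Language) : PRS L where
  eqns := fun _ _ _ => False
  neg := fun _ _ => False
  pos := fun _ _ => False
  neg_atomic := fun h => h.elim
  pos_atomic := fun h => h.elim

/-- Provability in predicate logic from a set of axioms `U`. -/
def PLProvableIn (U : Set (Form L)) (Γ Δ : Multiset (Form L)) : Prop :=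
  ProvableIn (emptyPRS L) U Γ Δ

/-- Compatibility of the theory `⟨rs, T⟩` with the set of axioms `U`. -/
structure Compatible (rs : PRS L) (T U : Set (Form L)) : Prop where
  rwNeg : ∀ A B : Form L, RwNegS rs A B → PLProvableIn U 0 {Form.imp A B}
  rwPos : ∀ A B : Form L, RwPosS rs A B → PLProvableIn U 0 {Form.imp B A}
  axT : ∀ A ∈ T, PLProvableIn U 0 {A}
  axU : ∀ A ∈ U, ProvableIn rs T 0 {A}
/-- The list of (sort, index) free variables of a term. -/
def Term.freeList : (s : L.Sorts) → Term L s → List ((s : L.Sorts) × ℕ)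
  | s, .var n => [⟨s, n⟩]
  | _, .func f args =>
      (List.finRange (L.arity f).length).flatMap fun i => Term.freeList _ (args i)

/-- Adjusting a list of free variables when leaving a binder of sort `s`. -/
def unbind (s : L.Sorts) (l : List ((s : L.Sorts) × ℕ)) :
    List ((s : L.Sorts) × ℕ) :=
  (l.filter fun v => decide ¬(v.1 = s ∧ v.2 = 0)).map fun v =>
    if v.1 = s then ⟨v.1, v.2 - 1⟩ else v

/-- The list of (sort, index) free variables of a proposition. -/
def Form.freeList : Form L → List ((s : L.Sorts) × ℕ)
  | .pred p args =>
      (List.finRange (L.parity p).length).flatMap fun i => Term.freeList _ (args i)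
  | .bot => []
  | .top => []
  | .not A => A.freeList
  | .and A B => A.freeList ++ B.freeList
  | .or A B => A.freeList ++ B.freeList
  | .imp A B => A.freeList ++ B.freeList
  | .all s A => unbind s A.freeList
  | .ex s A => unbind s A.freeList

/-- Universally quantify over the free variable `k` of sort `s`. -/
def Form.abstractVar (s : L.Sorts) (k : ℕ) (A : Form L) : Form L :=
  .all s (A.subst fun s' n =>
    if s' = s then (if n = k then .var 0 else .var (n + 1)) else .var n)

def closeSteps : ℕ → Form L → Form L
  | 0, A => A
  | n + 1, A =>
    match A.freeList with
    | [] => A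
    | v :: _ => closeSteps n (A.abstractVar v.1 v.2)

/-- The universal closure of a proposition. -/
def univClosure (A : Form L) : Form L := closeSteps A.freeList.length A

/-- The set of axioms `A_R` associated with a polarized rewrite system. -/
def axSetAR (rs : PRS L) : Set (Form L) :=
  {C | ∃ A B : Form L, RwNegS rs A B ∧ C = univClosure (A.imp B)} ∪
  {C | ∃ A B : Form L, RwPosS rs A B ∧ C = univClosure (B.imp A)}

/-- A (many-sorted, classical) first-order model of the language `L`. -/
structure Model (L : Language) : Type 1 where
  dom : L.Sorts → Type
  inhab : ∀ s, Nonempty (dom s)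
  interpF : (f : L.Func) →
      ((i : Fin (L.arity f).length) → dom ((L.arity f).get i)) → dom (L.ret f)
  interpP : (p : L.Pred) →
      ((i : Fin (L.parity p).length) → dom ((L.parity p).get i)) → Prop

/-- Valuations of the variables in a model. -/
def Model.Val (M : Model L) : Type := (s : L.Sorts) → ℕ → M.dom s

/-- Denotation of terms. -/
def Model.evalT (M : Model L) (φ : M.Val) : (s : L.Sorts) → Term L s → M.dom s
  | s, .var n => φ s n
  | _, .func f args => M.interpF f fun i => M.evalT φ _ (args i)

/-- Pushing a new value for the variable `0` of sort `s` into a valuation. -/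
def Model.push (M : Model L) (φ : M.Val) {s : L.Sorts} (d : M.dom s) : M.Val :=
  fun s' n =>
    if h : s = s' then
      match n with
      | 0 => h ▸ d
      | n + 1 => φ s' n
    else φ s' n

/-- Denotation (truth value) of propositions. -/
def Model.evalF (M : Model L) : M.Val → Form L → Prop
  | φ, .pred p args => M.interpP p fun i => M.evalT φ _ (args i)
  | _, .bot => False
  | _, .top => True
  | φ, .not A => ¬ M.evalF φ A
  | φ, .and A B => M.evalF φ A ∧ M.evalF φ B
  | φ, .or A B => M.evalF φ A ∨ M.evalF φ B
  | φ, .imp A B => M.evalF φ A → M.evalF φ B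
  | φ, .all s A => ∀ d : M.dom s, M.evalF (M.push φ d) A
  | φ, .ex s A => ∃ d : M.dom s, M.evalF (M.push φ d) A

/-- A proposition is valid in a model. -/
def Model.ValidForm (M : Model L) (A : Form L) : Prop := ∀ φ : M.Val, M.evalF φ A

/-- A sequent is valid in a model. -/
def Model.ValidSeq (M : Model L) (Γ Δ : Multiset (Form L)) : Prop :=
  ∀ φ : M.Val, (∀ A ∈ Γ, M.evalF φ A) → ∃ B ∈ Δ, M.evalF φ B

/-- `M` is a model of a set of axioms. -/
def IsModelOf (M : Model L) (S : Set (Form L)) : Prop := ∀ A ∈ S, M.ValidForm A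

/-- `M` is a model of the theory `⟨rs, T⟩`, i.e. a model of `A_R ∪ T`. -/
def IsModelOfTheory (M : Model L) (rs : PRS L) (T : Set (Form L)) : Prop :=
  IsModelOf M (axSetAR rs ∪ T)

/-- An equality model: terms congruent modulo `=_E` have the same denotation. -/
def IsEqualityModel (M : Model L) (rs : PRS L) : Prop :=
  ∀ (s : L.Sorts) (t u : Term L s), EqE rs s t u →
    ∀ φ : M.Val, M.evalT φ s t = M.evalT φ s u

/-- The relation `∼` on a domain of a model: being denotations of two
`=_E`-congruent terms. -/
def simRel (rs : PRS L) (M : Model L) (s : L.Sorts) (a b : M.dom s) : Prop :=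
  ∃ (t u : Term L s) (φ : M.Val),
    EqE rs s t u ∧ a = M.evalT φ s t ∧ b = M.evalT φ s u

/-- A literal: an atomic proposition or the negation of an atomic one. -/
def Form.IsLiteral (A : Form L) : Prop :=
  A.IsAtomic ∨ ∃ B : Form L, B.IsAtomic ∧ A = .not B

/-- Disjunctions of literals. -/
inductive IsDisj : Form L → Prop where
  | lit {A : Form L} : A.IsLiteral → IsDisj A
  | or {A B : Form L} : IsDisj A → IsDisj B → IsDisj (.or A B)

/-- Universally quantified disjunctions of literals. -/
inductive IsQuantClause : Form L → Prop where
  | disj {A : Form L} : IsDisj A → IsQuantClause A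
  | all {s : L.Sorts} {A : Form L} : IsQuantClause A → IsQuantClause (.all s A)

/-- A clausal proposition: `⊥` or `∀x₁…∀xₚ (L₁ ∨ … ∨ Lₙ)`. -/
def Form.IsClausal (A : Form L) : Prop := A = .bot ∨ IsQuantClause A

/-- A clausal polarized rewrite system. -/
def IsClausalSystem (rs : PRS L) : Prop :=
  (∀ P A : Form L, rs.neg P A → P.IsAtomic ∧ A.IsClausal) ∧
  (∀ P A : Form L, rs.pos P A → P.IsAtomic ∧ ∃ B : Form L, B.IsClausal ∧ A = .not B)
/-- The language obtained by adding an equality predicate in each sort. -/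
def withEq (L : Language) : Language where
  Sorts := L.Sorts
  Func := L.Func
  arity := L.arity
  ret := L.ret
  Pred := L.Pred ⊕ L.Sorts
  parity := fun p =>
    match p with
    | .inl p => L.parity p
    | .inr s => [s, s]

/-- The canonical embedding of terms of `L` into `withEq L`. -/
def Term.toEq : (s : L.Sorts) → Term L s → Term (withEq L) s
  | _, .var n => .var n
  | _, .func f args =>
      Term.func (L := withEq L) f fun i => Term.toEq _ (args i)

/-- The canonical embedding of propositions of `L` into `withEq L`. -/
def Form.toEq : Form L → Form (withEq L)
  | .pred p args => Form.pred (L := withEq L) (.inl p) fun i => Term.toEq (L := L) _ (args i)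
  | .bot => .bot
  | .top => .top
  | .not A => .not A.toEq
  | .and A B => .and A.toEq B.toEq
  | .or A B => .or A.toEq B.toEq
  | .imp A B => .imp A.toEq B.toEq
  | .all s A => .all s A.toEq
  | .ex s A => .ex s A.toEq

/-- The rewrite system `rs` viewed as a rewrite system of `withEq L`. -/
def PRS.toEq (rs : PRS L) : PRS (withEq L) where
  eqns := fun s t u =>
    ∃ t₀ u₀ : Term L s, rs.eqns s t₀ u₀ ∧ t = Term.toEq (L := L) s t₀ ∧ u = Term.toEq (L := L) s u₀
  neg := fun P A => ∃ P₀ A₀ : Form L, rs.neg P₀ A₀ ∧ P = P₀.toEq ∧ A = A₀.toEq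
  pos := fun P A => ∃ P₀ A₀ : Form L, rs.pos P₀ A₀ ∧ P = P₀.toEq ∧ A = A₀.toEq
  neg_atomic := by
    rintro P A ⟨P₀, A₀, h, rfl, rfl⟩
    have h' := rs.neg_atomic h
    cases P₀ <;> simp_all [Form.IsAtomic, Form.toEq]
  pos_atomic := by
    rintro P A ⟨P₀, A₀, h, rfl, rfl⟩
    have h' := rs.pos_atomic h
    cases P₀ <;> simp_all [Form.IsAtomic, Form.toEq]

/-- A two-element family of arguments. -/
def args2 {L' : Language} {s₁ s₂ : L'.Sorts} (t : Term L' s₁) (u : Term L' s₂) :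
    (i : Fin ([s₁, s₂] : List L'.Sorts).length) →
      Term L' (([s₁, s₂] : List L'.Sorts).get i)
  | ⟨0, _⟩ => t
  | ⟨1, _⟩ => u

/-- A one-element family of arguments. -/
def args1 {L' : Language} {s : L'.Sorts} (t : Term L' s) :
    (i : Fin ([s] : List L'.Sorts).length) → Term L' (([s] : List L'.Sorts).get i)
  | ⟨0, _⟩ => t

/-- The proposition `t = u` in `withEq L`. -/
def eqForm {s : L.Sorts} (t u : Term (withEq L) s) : Form (withEq L) :=
  .pred (.inr s) (args2 t u)

/-- Hypothesis `x₁ = y₁ ∧ … ∧ xₙ = yₙ` for the congruence axiom of a function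
symbol, where `xᵢ` is the variable `2i` and `yᵢ` the variable `2i+1`. -/
def congrHypF (f : L.Func) : Form (withEq L) :=
  (List.finRange (L.arity f).length).foldr
    (fun i C => .and (eqForm (s := (L.arity f).get i)
      (.var (2 * i.val)) (.var (2 * i.val + 1))) C) .top

/-- The congruence axiom for a function symbol. -/
def funcCongrAx (f : L.Func) : Form (withEq L) :=
  univClosure ((congrHypF f).imp
    (eqForm (Term.func (L := withEq L) f fun i => .var (2 * i.val))
            (Term.func (L := withEq L) f fun i => .var (2 * i.val + 1))))

/-- Hypothesis for the congruence axiom of a predicate symbol of `withEq L`. -/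
def congrHypP (p : (withEq L).Pred) : Form (withEq L) :=
  (List.finRange ((withEq L).parity p).length).foldr
    (fun i C => .and (eqForm (s := ((withEq L).parity p).get i)
      (.var (2 * i.val)) (.var (2 * i.val + 1))) C) .top

/-- The congruence (Leibniz) axiom for a predicate symbol. -/
def predCongrAx (p : (withEq L).Pred) : Form (withEq L) :=
  univClosure ((congrHypP p).imp
    ((Form.pred p fun i => .var (2 * i.val)).imp
      (Form.pred p fun i => .var (2 * i.val + 1))))

/-- The axioms of equality for the language `withEq L`. -/
def EqAxioms (L : Language) : Set (Form (withEq L)) :=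
  {C | ∃ s : L.Sorts,
      C = univClosure (eqForm (s := s) (.var 0) (.var 0))} ∪
  {C | ∃ s : L.Sorts,
      C = univClosure ((eqForm (s := s) (.var 0) (.var 1)).imp
        (eqForm (s := s) (.var 1) (.var 0)))} ∪
  {C | ∃ s : L.Sorts,
      C = univClosure ((Form.and (eqForm (s := s) (.var 0) (.var 1))
        (eqForm (s := s) (.var 1) (.var 2))).imp
          (eqForm (s := s) (.var 0) (.var 2)))} ∪
  {C | ∃ f : L.Func, C = funcCongrAx f} ∪
  {C | ∃ p : (withEq L).Pred, C = predCongrAx p}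

/-- The set of axioms `U_R` associated with a polarized rewrite system over a
language with equality. -/
def URset {L₀ : Language} (rs : PRS (withEq L₀)) : Set (Form (withEq L₀)) :=
  EqAxioms L₀ ∪
  {C | ∃ (s : L₀.Sorts) (t u : Term (withEq L₀) s),
      rs.eqns s t u ∧ C = univClosure (eqForm t u)} ∪
  {C | ∃ P A : Form (withEq L₀), rs.neg P A ∧ C = univClosure (P.imp A)} ∪
  {C | ∃ P A : Form (withEq L₀), rs.pos P A ∧ C = univClosure (A.imp P)}
/-! ### Simple Type Theory: the theories HOL and HOL± -/

/-- Simple types. -/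
inductive STy : Type where
  | iota : STy
  | o : STy
  | arr (T U : STy) : STy

/-- The function symbols of HOL. -/
inductive HFunc : Type where
  | K (T U : STy) : HFunc
  | S (T U V : STy) : HFunc
  | dor : HFunc
  | dnot : HFunc
  | dall (T : STy) : HFunc
  | zero : HFunc
  | succ : HFunc
  | pred : HFunc
  | null : HFunc
  | app (T U : STy) : HFunc

def HFunc.arity : HFunc → List STy
  | .app T U => [.arr T U, T]
  | _ => []

def HFunc.ret : HFunc → STy
  | .K T U => .arr T (.arr U T)
  | .S T U V => .arr (.arr T (.arr U V)) (.arr (.arr T U) (.arr T V))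
  | .dor => .arr .o (.arr .o .o)
  | .dnot => .arr .o .o
  | .dall T => .arr (.arr T .o) .o
  | .zero => .iota
  | .succ => .arr .iota .iota
  | .pred => .arr .iota .iota
  | .null => .arr .iota .o
  | .app _ U => U

/-- The language of HOL: sorts are simple types, and `ε` is the unique
predicate symbol, of rank `⟨o⟩`. -/
def LHOL : Language where
  Sorts := STy
  Func := HFunc
  arity := HFunc.arity
  ret := HFunc.ret
  Pred := Unit
  parity := fun _ => [STy.o]

/-- The language of HOL±: that of HOL plus a symbol `H_T` of sort
`(T → o) → T` for each sort `T`. -/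
def LHOLpm : Language where
  Sorts := STy
  Func := HFunc ⊕ STy
  arity := fun f =>
    match f with
    | .inl f => f.arity
    | .inr T => [STy.arr T STy.o]
  ret := fun f =>
    match f with
    | .inl f => f.ret
    | .inr T => T
  Pred := Unit
  parity := fun _ => [STy.o]

/-- Application in HOL. -/
def hap {T U : STy} (t : Term LHOL (STy.arr T U)) (u : Term LHOL T) :
    Term LHOL U :=
  Term.func (L := LHOL) (HFunc.app T U) (args2 (L' := LHOL) t u)

/-- Application in HOL±. -/
def pap {T U : STy} (t : Term LHOLpm (STy.arr T U)) (u : Term LHOLpm T) :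
    Term LHOLpm U :=
  Term.func (L := LHOLpm) (Sum.inl (HFunc.app T U)) (args2 (L' := LHOLpm) t u)

/-- The Hilbert symbol `H_T` applied to a term, in HOL±. -/
def hH (T : STy) (t : Term LHOLpm (STy.arr T STy.o)) : Term LHOLpm T :=
  Term.func (L := LHOLpm) (Sum.inr T) (args1 (L' := LHOLpm) t)

/-- The constants of HOL. -/
def hK (T U : STy) : Term LHOL (HFunc.ret (.K T U)) :=
  Term.func (L := LHOL) (HFunc.K T U) finZeroElim
def hS (T U V : STy) : Term LHOL (HFunc.ret (.S T U V)) :=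
  Term.func (L := LHOL) (HFunc.S T U V) finZeroElim
def hOr : Term LHOL (HFunc.ret .dor) :=
  Term.func (L := LHOL) HFunc.dor finZeroElim
def hNot : Term LHOL (HFunc.ret .dnot) :=
  Term.func (L := LHOL) HFunc.dnot finZeroElim
def hAll (T : STy) : Term LHOL (HFunc.ret (.dall T)) :=
  Term.func (L := LHOL) (HFunc.dall T) finZeroElim
def hZero : Term LHOL (HFunc.ret .zero) :=
  Term.func (L := LHOL) HFunc.zero finZeroElim
def hSucc : Term LHOL (HFunc.ret .succ) :=
  Term.func (L := LHOL) HFunc.succ finZeroElim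
def hPred : Term LHOL (HFunc.ret .pred) :=
  Term.func (L := LHOL) HFunc.pred finZeroElim
def hNull : Term LHOL (HFunc.ret .null) :=
  Term.func (L := LHOL) HFunc.null finZeroElim

/-- The constants of HOL±. -/
def pK (T U : STy) : Term LHOLpm (HFunc.ret (.K T U)) :=
  Term.func (L := LHOLpm) (Sum.inl (HFunc.K T U)) finZeroElim
def pS (T U V : STy) : Term LHOLpm (HFunc.ret (.S T U V)) :=
  Term.func (L := LHOLpm) (Sum.inl (HFunc.S T U V)) finZeroElim
def pOr : Term LHOLpm (HFunc.ret .dor) :=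
  Term.func (L := LHOLpm) (Sum.inl HFunc.dor) finZeroElim
def pNot : Term LHOLpm (HFunc.ret .dnot) :=
  Term.func (L := LHOLpm) (Sum.inl HFunc.dnot) finZeroElim
def pAll (T : STy) : Term LHOLpm (HFunc.ret (.dall T)) :=
  Term.func (L := LHOLpm) (Sum.inl (HFunc.dall T)) finZeroElim
def pZero : Term LHOLpm (HFunc.ret .zero) :=
  Term.func (L := LHOLpm) (Sum.inl HFunc.zero) finZeroElim
def pSucc : Term LHOLpm (HFunc.ret .succ) :=
  Term.func (L := LHOLpm) (Sum.inl HFunc.succ) finZeroElim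
def pPred : Term LHOLpm (HFunc.ret .pred) :=
  Term.func (L := LHOLpm) (Sum.inl HFunc.pred) finZeroElim
def pNull : Term LHOLpm (HFunc.ret .null) :=
  Term.func (L := LHOLpm) (Sum.inl HFunc.null) finZeroElim

/-- The proposition `ε(t)` of HOL. -/
def hEps (t : Term LHOL STy.o) : Form LHOL :=
  Form.pred (L := LHOL) () (args1 (L' := LHOL) t)

/-- The proposition `ε(t)` of HOL±. -/
def pEps (t : Term LHOLpm STy.o) : Form LHOLpm :=
  Form.pred (L := LHOLpm) () (args1 (L' := LHOLpm) t)

/-- The equations of HOL (and of HOL±), on the language of HOL. -/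
inductive HOLEq : (s : STy) → Term LHOL s → Term LHOL s → Prop where
  | Keq (T U : STy) :
      HOLEq T (hap (hap (hK T U) (.var 0)) (.var 1)) (.var 0)
  | Seq (T U V : STy) :
      HOLEq V (hap (hap (hap (hS T U V) (.var 0)) (.var 1)) (.var 2))
        (hap (hap (.var 0) (.var 2)) (hap (.var 1) (.var 2)))
  | PredSucc :
      HOLEq .iota (hap (hPred) (hap (hSucc) (.var 0))) (.var 0)

/-- The rewrite rules of HOL (used both negatively and positively). -/
inductive HOLRule : Form LHOL → Form LHOL → Prop where
  | orRule :
      HOLRule (hEps (hap (hap (hOr) (.var 0)) (.var 1)))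
        (.or (hEps (.var 0)) (hEps (.var 1)))
  | notRule :
      HOLRule (hEps (hap (hNot) (.var 0))) (.not (hEps (.var 0)))
  | allRule (T : STy) :
      HOLRule (hEps (hap (hAll T) (.var 0)))
        (.all T (hEps (hap (.var 0) (.var 0))))
  | nullSucc :
      HOLRule (hEps (hap (hNull) (hap (hSucc) (.var 0)))) .bot
  | nullZero :
      HOLRule (hEps (hap (hNull) (hZero))) .top

/-- The (non polarized) rewrite system HOL, each rule being taken both as a
negative and as a positive rule. -/
def HOLsys : PRS LHOL where
  eqns := HOLEq
  neg := HOLRule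
  pos := HOLRule
  neg_atomic := by rintro P A h; cases h <;> trivial
  pos_atomic := by rintro P A h; cases h <;> trivial

/-- The equations of HOL±. -/
inductive HOLpmEq : (s : STy) → Term LHOLpm s → Term LHOLpm s → Prop where
  | Keq (T U : STy) :
      HOLpmEq T (pap (pap (pK T U) (.var 0)) (.var 1)) (.var 0)
  | Seq (T U V : STy) :
      HOLpmEq V (pap (pap (pap (pS T U V) (.var 0)) (.var 1)) (.var 2))
        (pap (pap (.var 0) (.var 2)) (pap (.var 1) (.var 2)))
  | PredSucc :
      HOLpmEq .iota (pap (pPred) (pap (pSucc) (.var 0))) (.var 0)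

/-- The negative rules of HOL±. -/
inductive HOLpmNeg : Form LHOLpm → Form LHOLpm → Prop where
  | orRule :
      HOLpmNeg (pEps (pap (pap (pOr) (.var 0)) (.var 1)))
        (.or (pEps (.var 0)) (pEps (.var 1)))
  | notRule :
      HOLpmNeg (pEps (pap (pNot) (.var 0))) (.not (pEps (.var 0)))
  | allRule (T : STy) :
      HOLpmNeg (pEps (pap (pAll T) (.var 0)))
        (.all T (pEps (pap (.var 0) (.var 0))))
  | nullSucc :
      HOLpmNeg (pEps (pap (pNull) (pap (pSucc) (.var 0)))) .bot

/-- The positive rules of HOL±. -/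
inductive HOLpmPos : Form LHOLpm → Form LHOLpm → Prop where
  | orRule₁ :
      HOLpmPos (pEps (pap (pap (pOr) (.var 0)) (.var 1)))
        (.not (.not (pEps (.var 0))))
  | orRule₂ :
      HOLpmPos (pEps (pap (pap (pOr) (.var 0)) (.var 1)))
        (.not (.not (pEps (.var 1))))
  | notRule :
      HOLpmPos (pEps (pap (pNot) (.var 0))) (.not (pEps (.var 0)))
  | allRule (T : STy) :
      HOLpmPos (pEps (pap (pAll T) (.var 0)))
        (.not (.not (pEps (pap (.var 0) (hH T (.var 0))))))
  | nullZero :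
      HOLpmPos (pEps (pap (pNull) (pZero))) (.not .bot)

/-- The clausal polarized rewrite system HOL±. -/
def HOLpm : PRS LHOLpm where
  eqns := HOLpmEq
  neg := HOLpmNeg
  pos := HOLpmPos
  neg_atomic := by rintro P A h; cases h <;> trivial
  pos_atomic := by rintro P A h; cases h <;> trivial

/-- The embedding of the terms of HOL into those of HOL±. -/
def embT : (s : STy) → Term LHOL s → Term LHOLpm s
  | _, .var n => .var n
  | _, .func f args => Term.func (L := LHOLpm) (Sum.inl f) fun i => embT _ (args i)

/-- The embedding of the propositions of HOL into those of HOL±; a proposition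
of HOL± contains no occurrence of the symbols `H_T` if and only if it is in the
image of this embedding. -/
def embF : Form LHOL → Form LHOLpm
  | .pred _ args => Form.pred (L := LHOLpm) () fun i => embT _ (args i)
  | .bot => .bot
  | .top => .top
  | .not A => .not (embF A)
  | .and A B => .and (embF A) (embF B)
  | .or A B => .or (embF A) (embF B)
  | .imp A B => .imp (embF A) (embF B)
  | .all s A => .all s (embF A)
  | .ex s A => .ex s (embF A)

theorem liftSubst_zero (s : L.Sorts) (σ : (s : L.Sorts) → ℕ → Term L s) :
    liftSubst s σ s 0 = .var 0 := by
  simp [liftSubst]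

theorem liftSubst_succ (s : L.Sorts) (σ : (s : L.Sorts) → ℕ → Term L s) (n : ℕ) :
    liftSubst s σ s (n + 1) = Term.rename (shiftRen s) s (σ s n) := by
  simp [liftSubst]

theorem liftSubst_of_ne {s s₀ : L.Sorts} (h : s ≠ s₀) (σ : (s : L.Sorts) → ℕ → Term L s)
    (n : ℕ) : liftSubst s₀ σ s n = Term.rename (shiftRen s₀) s (σ s n) := by
  simp [liftSubst, h]

theorem Term.rename_eq_subst (ρ : (s : L.Sorts) → ℕ → ℕ) (s : L.Sorts) (t : Term L s) :
    Term.rename ρ s t = Term.subst (fun s n => .var (ρ s n)) s t := by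
  induction t with
  | var n => rfl
  | func f args ih => simp only [Term.rename, Term.subst, ih]

theorem liftSubst_var (s₀ : L.Sorts) (ρ : (s : L.Sorts) → ℕ → ℕ) :
    liftSubst s₀ (fun s n => .var (ρ s n)) = fun s n => .var (liftRen s₀ ρ s n) := by
  funext s n
  by_cases h : s = s₀
  · cases n <;> simp [liftSubst, liftRen, h, Term.rename, shiftRen]
  · simp [liftSubst, liftRen, h, Term.rename, shiftRen]

theorem Form.rename_eq_subst (ρ : (s : L.Sorts) → ℕ → ℕ) (A : Form L) :
    Form.rename ρ A = Form.subst (fun s n => .var (ρ s n)) A := by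
  induction A generalizing ρ with
  | pred p args => simp only [Form.rename, Form.subst, Term.rename_eq_subst]
  | bot => rfl
  | top => rfl
  | not A ih => simp only [Form.rename, Form.subst, ih]
  | and A B ihA ihB => simp only [Form.rename, Form.subst, ihA, ihB]
  | or A B ihA ihB => simp only [Form.rename, Form.subst, ihA, ihB]
  | imp A B ihA ihB => simp only [Form.rename, Form.subst, ihA, ihB]
  | all s A ih => simp only [Form.rename, Form.subst, ih, liftSubst_var]
  | ex s A ih => simp only [Form.rename, Form.subst, ih, liftSubst_var]

theorem Term.subst_subst (σ τ : (s : L.Sorts) → ℕ → Term L s) (s : L.Sorts) (t : Term L s) :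
    Term.subst τ s (Term.subst σ s t) = Term.subst (fun s n => Term.subst τ s (σ s n)) s t := by
  induction t with
  | var n => rfl
  | func f args ih => simp only [Term.subst, ih]

theorem Term.subst_var (s : L.Sorts) (t : Term L s) :
    Term.subst (fun _ n => .var n) s t = t := by
  induction t with
  | var n => rfl
  | func f args ih => simp only [Term.subst, ih]

theorem liftSubst_shiftRen (s₀ : L.Sorts) (σ : (s : L.Sorts) → ℕ → Term L s) (s : L.Sorts)
    (n : ℕ) :
    liftSubst s₀ σ s (shiftRen s₀ s n) = Term.rename (shiftRen s₀) s (σ s n) := by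
  by_cases h : s = s₀ <;> simp [liftSubst, shiftRen, h]

theorem Term.subst_liftSubst_shift (s₀ : L.Sorts) (σ : (s : L.Sorts) → ℕ → Term L s)
    (s : L.Sorts) (t : Term L s) :
    Term.subst (liftSubst s₀ σ) s (Term.rename (shiftRen s₀) s t) =
      Term.rename (shiftRen s₀) s (Term.subst σ s t) := by
  rw [Term.rename_eq_subst, Term.subst_subst, Term.rename_eq_subst, Term.subst_subst]
  simp only [Term.subst, liftSubst_shiftRen, Term.rename_eq_subst]

theorem liftSubst_comp (s₀ : L.Sorts) (σ τ : (s : L.Sorts) → ℕ → Term L s) :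
    (fun s n => Term.subst (liftSubst s₀ τ) s (liftSubst s₀ σ s n)) =
      liftSubst s₀ (fun s n => Term.subst τ s (σ s n)) := by
  funext s n
  by_cases h : s = s₀
  · cases n with
    | zero => simp [liftSubst, h, Term.subst]
    | succ n =>
      have e := Term.subst_liftSubst_shift s₀ τ s (σ s n)
      simpa [liftSubst, h] using e
  · have e := Term.subst_liftSubst_shift s₀ τ s (σ s n)
    simpa [liftSubst, h] using e

theorem Form.subst_subst (σ τ : (s : L.Sorts) → ℕ → Term L s) (A : Form L) :
    Form.subst τ (Form.subst σ A) = Form.subst (fun s n => Term.subst τ s (σ s n)) A := by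
  induction A generalizing σ τ with
  | pred p args => simp only [Form.subst, Term.subst_subst]
  | bot => rfl
  | top => rfl
  | not A ih => simp only [Form.subst, ih]
  | and A B ihA ihB => simp only [Form.subst, ihA, ihB]
  | or A B ihA ihB => simp only [Form.subst, ihA, ihB]
  | imp A B ihA ihB => simp only [Form.subst, ihA, ihB]
  | all s A ih => simp only [Form.subst, ih, liftSubst_comp]
  | ex s A ih => simp only [Form.subst, ih, liftSubst_comp]

theorem Form.subst_var (A : Form L) : Form.subst (fun _ n => .var n) A = A := by
  induction A with
  | pred p args => simp only [Form.subst, Term.subst_var]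
  | bot => rfl
  | top => rfl
  | not A ih => simp only [Form.subst, ih]
  | and A B ihA ihB => simp only [Form.subst, ihA, ihB]
  | or A B ihA ihB => simp only [Form.subst, ihA, ihB]
  | imp A B ihA ihB => simp only [Form.subst, ihA, ihB]
  | all s A ih | ex s A ih =>
    have e : liftRen s (fun (_ : L.Sorts) n => n) = fun _ n => n := by
      funext s' n
      by_cases h : s' = s
      · cases n <;> simp [liftRen, h]
      · simp [liftRen, h]
    simp only [Form.subst, liftSubst_var s (fun _ n => n), e, ih]

/-- Extend a substitution with a value for the variable `0` of sort `s`. -/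
def pushSubst {s : L.Sorts} (σ : (s : L.Sorts) → ℕ → Term L s) (t : Term L s) :
    (s : L.Sorts) → ℕ → Term L s :=
  fun s' n =>
    if h : s = s' then
      match n with
      | 0 => h ▸ t
      | n + 1 => σ s' n
    else σ s' n

theorem pushSubst_zero {s : L.Sorts} (σ : (s : L.Sorts) → ℕ → Term L s) (t : Term L s) :
    pushSubst σ t s 0 = t := by
  simp [pushSubst]

theorem pushSubst_succ {s : L.Sorts} (σ : (s : L.Sorts) → ℕ → Term L s) (t : Term L s)
    (n : ℕ) : pushSubst σ t s (n + 1) = σ s n := by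
  simp [pushSubst]

theorem pushSubst_of_ne {s s' : L.Sorts} (h : s ≠ s') (σ : (s : L.Sorts) → ℕ → Term L s)
    (t : Term L s) (n : ℕ) : pushSubst σ t s' n = σ s' n := by
  simp [pushSubst, h]

theorem subst0_eq_pushSubst {s : L.Sorts} (t : Term L s) :
    subst0 t = pushSubst (fun _ n => .var n) t := rfl

theorem pushSubst_shiftRen {s : L.Sorts} (σ : (s : L.Sorts) → ℕ → Term L s) (t : Term L s)
    (s' : L.Sorts) (n : ℕ) : pushSubst σ t s' (shiftRen s s' n) = σ s' n := by
  by_cases h : s = s'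
  · subst h; simp [pushSubst, shiftRen]
  · simp [pushSubst, shiftRen, h, Ne.symm h]

theorem pushSubst_comp {s : L.Sorts} (σ τ : (s : L.Sorts) → ℕ → Term L s) (t : Term L s) :
    (fun s' n => Term.subst τ s' (pushSubst σ t s' n)) =
      pushSubst (fun s' n => Term.subst τ s' (σ s' n)) (Term.subst τ s t) := by
  funext s' n
  by_cases h : s = s'
  · subst h; cases n <;> simp [pushSubst]
  · simp [pushSubst, h]

theorem pushSubst_liftSubst {s : L.Sorts} (σ τ : (s : L.Sorts) → ℕ → Term L s) (t : Term L s) :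
    (fun s' n => Term.subst (pushSubst τ t) s' (liftSubst s σ s' n)) =
      pushSubst (fun s' n => Term.subst τ s' (σ s' n)) t := by
  funext s' n
  have e : ∀ m, Term.subst (pushSubst τ t) s' (Term.rename (shiftRen s) s' (σ s' m)) =
      Term.subst τ s' (σ s' m) := fun m => by
    rw [Term.rename_eq_subst, Term.subst_subst]
    simp only [Term.subst, pushSubst_shiftRen]
  by_cases h : s = s'
  · subst h
    cases n with
    | zero => simp [pushSubst, liftSubst, Term.subst]
    | succ n => simpa [pushSubst, liftSubst] using e n
  · simpa [pushSubst, liftSubst, h, Ne.symm h] using e n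

theorem Form.inst_subst_liftSubst {s : L.Sorts} (σ : (s : L.Sorts) → ℕ → Term L s)
    (t : Term L s) (A : Form L) :
    Form.inst t (Form.subst (liftSubst s σ) A) = Form.subst (pushSubst σ t) A := by
  rw [Form.inst, Form.subst_subst, subst0_eq_pushSubst, pushSubst_liftSubst]
  simp only [Term.subst_var]

theorem Form.subst_inst {s : L.Sorts} (σ : (s : L.Sorts) → ℕ → Term L s)
    (t : Term L s) (A : Form L) :
    Form.subst σ (Form.inst t A) =
      Form.inst (Term.subst σ s t) (Form.subst (liftSubst s σ) A) := by
  rw [Form.inst_subst_liftSubst, Form.inst, Form.subst_subst, subst0_eq_pushSubst,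
    pushSubst_comp]
  rfl

theorem Form.subst_liftSubst_shift (s : L.Sorts) (σ : (s : L.Sorts) → ℕ → Term L s)
    (A : Form L) :
    Form.subst (liftSubst s σ) (Form.shift s A) = Form.shift s (Form.subst σ A) := by
  rw [Form.shift, Form.shift, Form.rename_eq_subst, Form.rename_eq_subst, Form.subst_subst,
    Form.subst_subst]
  simp only [Term.subst, liftSubst_shiftRen, Term.rename_eq_subst]

theorem Term.exists_subst_congr_bound (s : L.Sorts) (t : Term L s) :
    ∃ N : ℕ, ∀ σ τ : (s : L.Sorts) → ℕ → Term L s, (∀ s, ∀ n < N, σ s n = τ s n) →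
      Term.subst σ s t = Term.subst τ s t := by
  induction t with
  | var n => exact ⟨n + 1, fun σ τ h => h _ n (Nat.lt_succ_self n)⟩
  | func f args ih =>
    choose N hN using ih
    refine ⟨Finset.univ.sup N, fun σ τ h => ?_⟩
    simp only [Term.subst]
    congr 1
    funext i
    exact hN i σ τ fun s n hn => h s n (hn.trans_le (Finset.le_sup (Finset.mem_univ i)))

theorem liftSubst_congr {s₀ : L.Sorts} {N : ℕ} {σ τ : (s : L.Sorts) → ℕ → Term L s}
    (h : ∀ s, ∀ n < N, σ s n = τ s n) :
    ∀ s, ∀ n < N, liftSubst s₀ σ s n = liftSubst s₀ τ s n := by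
  intro s n hn
  by_cases e : s = s₀
  · cases n with
    | zero => simp [liftSubst, e]
    | succ n => simp only [liftSubst, e, if_true]; rw [h _ n (by omega)]
  · simp only [liftSubst, e, if_false]; rw [h _ n hn]

theorem Form.exists_subst_congr_bound (A : Form L) :
    ∃ N : ℕ, ∀ σ τ : (s : L.Sorts) → ℕ → Term L s, (∀ s, ∀ n < N, σ s n = τ s n) →
      Form.subst σ A = Form.subst τ A := by
  induction A with
  | pred p args =>
    choose N hN using fun i => Term.exists_subst_congr_bound _ (args i)
    refine ⟨Finset.univ.sup N, fun σ τ h => ?_⟩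
    simp only [Form.subst]
    congr 1
    funext i
    exact hN i σ τ fun s n hn => h s n (hn.trans_le (Finset.le_sup (Finset.mem_univ i)))
  | bot => exact ⟨0, fun _ _ _ => rfl⟩
  | top => exact ⟨0, fun _ _ _ => rfl⟩
  | not A ih =>
    obtain ⟨N, hN⟩ := ih
    exact ⟨N, fun σ τ h => by simp only [Form.subst, hN σ τ h]⟩
  | and A B ihA ihB | or A B ihA ihB | imp A B ihA ihB =>
    obtain ⟨N, hN⟩ := ihA
    obtain ⟨M, hM⟩ := ihB
    refine ⟨max N M, fun σ τ h => ?_⟩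
    simp only [Form.subst, hN σ τ fun s n hn => h s n (lt_max_of_lt_left hn),
      hM σ τ fun s n hn => h s n (lt_max_of_lt_right hn)]
  | all s A ih | ex s A ih =>
    obtain ⟨N, hN⟩ := ih
    exact ⟨N, fun σ τ h => by simp only [Form.subst, hN _ _ (liftSubst_congr h)]⟩

theorem exists_subst_congr_bound_multiset (Γ : Multiset (Form L)) :
    ∃ N : ℕ, ∀ A ∈ Γ, ∀ σ τ : (s : L.Sorts) → ℕ → Term L s,
      (∀ s, ∀ n < N, σ s n = τ s n) → Form.subst σ A = Form.subst τ A := by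
  induction Γ using Multiset.induction_on with
  | empty => exact ⟨0, by simp⟩
  | cons A Γ ih =>
    obtain ⟨N, hN⟩ := A.exists_subst_congr_bound
    obtain ⟨M, hM⟩ := ih
    refine ⟨max N M, fun B hB σ τ h => ?_⟩
    rcases Multiset.mem_cons.1 hB with rfl | hB
    · exact hN σ τ fun s n hn => h s n (lt_max_of_lt_left hn)
    · exact hM B hB σ τ fun s n hn => h s n (lt_max_of_lt_right hn)

theorem EqE.subst {rs : PRS L} {s : L.Sorts} {t u : Term L s}
    (σ : (s : L.Sorts) → ℕ → Term L s) (h : EqE rs s t u) :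
    EqE rs s (Term.subst σ s t) (Term.subst σ s u) := by
  induction h with
  | base τ h => rw [Term.subst_subst, Term.subst_subst]; exact .base _ h
  | refl t => exact .refl _
  | symm _ ih => exact .symm ih
  | trans _ _ ih₁ ih₂ => exact .trans ih₁ ih₂
  | congr f _ ih => exact .congr f ih

mutual
theorem RwNeg.subst {rs : PRS L} {A B : Form L} :
    RwNeg rs A B → ∀ σ : (s : L.Sorts) → ℕ → Term L s,
      RwNeg rs (Form.subst σ A) (Form.subst σ B)
  | .predArg p args args' i h hj, σ =>
      .predArg p _ _ i (h.subst σ) fun j hne => congrArg (Term.subst σ _) (hj j hne)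
  | .rule τ h, σ => by rw [Form.subst_subst, Form.subst_subst]; exact .rule _ h
  | .notC h, σ => .notC (h.subst σ)
  | .andL h, σ => .andL (h.subst σ)
  | .andR h, σ => .andR (h.subst σ)
  | .orL h, σ => .orL (h.subst σ)
  | .orR h, σ => .orR (h.subst σ)
  | .impL h, σ => .impL (h.subst σ)
  | .impR h, σ => .impR (h.subst σ)
  | .allC h, σ => .allC (h.subst (liftSubst _ σ))
  | .exC h, σ => .exC (h.subst (liftSubst _ σ))
theorem RwPos.subst {rs : PRS L} {A B : Form L} :
    RwPos rs A B → ∀ σ : (s : L.Sorts) → ℕ → Term L s,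
      RwPos rs (Form.subst σ A) (Form.subst σ B)
  | .predArg p args args' i h hj, σ =>
      .predArg p _ _ i (h.subst σ) fun j hne => congrArg (Term.subst σ _) (hj j hne)
  | .rule τ h, σ => by rw [Form.subst_subst, Form.subst_subst]; exact .rule _ h
  | .notC h, σ => .notC (h.subst σ)
  | .andL h, σ => .andL (h.subst σ)
  | .andR h, σ => .andR (h.subst σ)
  | .orL h, σ => .orL (h.subst σ)
  | .orR h, σ => .orR (h.subst σ)
  | .impL h, σ => .impL (h.subst σ)
  | .impR h, σ => .impR (h.subst σ)
  | .allC h, σ => .allC (h.subst (liftSubst _ σ))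
  | .exC h, σ => .exC (h.subst (liftSubst _ σ))
end

theorem RwNegS.subst {rs : PRS L} {A B : Form L} (σ : (s : L.Sorts) → ℕ → Term L s)
    (h : RwNegS rs A B) : RwNegS rs (Form.subst σ A) (Form.subst σ B) :=
  Relation.ReflTransGen.lift (Form.subst σ) (fun _ _ h => h.subst σ) _ _ h

theorem RwPosS.subst {rs : PRS L} {A B : Form L} (σ : (s : L.Sorts) → ℕ → Term L s)
    (h : RwPosS rs A B) : RwPosS rs (Form.subst σ A) (Form.subst σ B) :=
  Relation.ReflTransGen.lift (Form.subst σ) (fun _ _ h => h.subst σ) _ _ h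

theorem Form.IsAtomic.subst {A : Form L} (σ : (s : L.Sorts) → ℕ → Term L s)
    (h : A.IsAtomic) : (Form.subst σ A).IsAtomic := by
  cases A <;> simp_all [Form.IsAtomic, Form.subst]

theorem map_subst_liftSubst_shift (s : L.Sorts) (σ : (s : L.Sorts) → ℕ → Term L s)
    (Γ : Multiset (Form L)) :
    (Γ.map (Form.shift s)).map (Form.subst (liftSubst s σ)) =
      (Γ.map (Form.subst σ)).map (Form.shift s) := by
  simp only [Multiset.map_map, Function.comp_def, Form.subst_liftSubst_shift]

theorem Pf.subst {rs : PRS L} {c : Bool} {n : ℕ} {Γ Δ : Multiset (Form L)}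
    (h : Pf rs c n Γ Δ) (σ : (s : L.Sorts) → ℕ → Term L s) :
    Pf rs c n (Γ.map (Form.subst σ)) (Δ.map (Form.subst σ)) := by
  induction h generalizing σ with
  | ax hP h₁ h₂ => exact .ax (hP.subst σ) (h₁.subst σ) (h₂.subst σ)
  | cut hc h₁ h₂ _ _ ih₁ ih₂ =>
    have i₁ := ih₁ σ
    have i₂ := ih₂ σ
    simp only [Multiset.map_cons] at i₁ i₂ ⊢
    exact .cut hc (h₁.subst σ) (h₂.subst σ) i₁ i₂
  | contrL h₁ h₂ _ ih =>
    have i := ih σ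
    simp only [Multiset.map_cons] at i ⊢
    exact .contrL (h₁.subst σ) (h₂.subst σ) i
  | contrR h₁ h₂ _ ih =>
    have i := ih σ
    simp only [Multiset.map_cons] at i ⊢
    exact .contrR (h₁.subst σ) (h₂.subst σ) i
  | weakL _ ih => rw [Multiset.map_cons]; exact .weakL (ih σ)
  | weakR _ ih => rw [Multiset.map_cons]; exact .weakR (ih σ)
  | topR h => rw [Multiset.map_cons]; exact .topR (h.subst σ)
  | botL h => rw [Multiset.map_cons]; exact .botL (h.subst σ)
  | notL h _ ih =>
    have i := ih σ
    simp only [Multiset.map_cons] at i ⊢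
    exact .notL (h.subst σ) i
  | notR h _ ih =>
    have i := ih σ
    simp only [Multiset.map_cons] at i ⊢
    exact .notR (h.subst σ) i
  | andL h _ ih =>
    have i := ih σ
    simp only [Multiset.map_cons] at i ⊢
    exact .andL (h.subst σ) i
  | andR h _ _ ih₁ ih₂ =>
    have i₁ := ih₁ σ
    have i₂ := ih₂ σ
    simp only [Multiset.map_cons] at i₁ i₂ ⊢
    exact .andR (h.subst σ) i₁ i₂
  | orL h _ _ ih₁ ih₂ =>
    have i₁ := ih₁ σ
    have i₂ := ih₂ σ
    simp only [Multiset.map_cons] at i₁ i₂ ⊢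
    exact .orL (h.subst σ) i₁ i₂
  | orR h _ ih =>
    have i := ih σ
    simp only [Multiset.map_cons] at i ⊢
    exact .orR (h.subst σ) i
  | impL h _ _ ih₁ ih₂ =>
    have i₁ := ih₁ σ
    have i₂ := ih₂ σ
    simp only [Multiset.map_cons] at i₁ i₂ ⊢
    exact .impL (h.subst σ) i₁ i₂
  | impR h _ ih =>
    have i := ih σ
    simp only [Multiset.map_cons] at i ⊢
    exact .impR (h.subst σ) i
  | allL h₁ h₂ _ ih =>
    have i := ih σ
    have h₂ := h₂.subst σ
    rw [Form.subst_inst] at h₂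
    simp only [Multiset.map_cons] at i ⊢
    exact .allL (h₁.subst σ) h₂ i
  | @allR Γ Δ s A B n h _ ih =>
    have i := ih (liftSubst s σ)
    simp only [Multiset.map_cons, map_subst_liftSubst_shift] at i ⊢
    exact .allR (h.subst σ) i
  | @exL Γ Δ s A B n h _ ih =>
    have i := ih (liftSubst s σ)
    simp only [Multiset.map_cons, map_subst_liftSubst_shift] at i ⊢
    exact .exL (h.subst σ) i
  | exR h₁ h₂ _ ih =>
    have i := ih σ
    have h₂ := h₂.subst σ
    rw [Form.subst_inst] at h₂
    simp only [Multiset.map_cons] at i ⊢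
    exact .exR (h₁.subst σ) h₂ i

theorem RwNegS.refl {rs : PRS L} (A : Form L) : RwNegS rs A A := Relation.ReflTransGen.refl

theorem RwPosS.refl {rs : PRS L} (A : Form L) : RwPosS rs A A := Relation.ReflTransGen.refl

section DerivedRules

variable {rs : PRS L} {Γ Δ : Multiset (Form L)} {A B : Form L}

theorem Provable.subst (h : Provable rs Γ Δ) (σ : (s : L.Sorts) → ℕ → Term L s) :
    Provable rs (Γ.map (Form.subst σ)) (Δ.map (Form.subst σ)) :=
  h.imp fun _ h => h.subst σ

theorem Provable.add (h : Provable rs Γ Δ) (Γ' Δ' : Multiset (Form L)) :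
    Provable rs (Γ + Γ') (Δ + Δ') := by
  induction Γ' using Multiset.induction_on with
  | empty =>
    induction Δ' using Multiset.induction_on with
    | empty => simpa using h
    | cons B Δ' ih =>
      obtain ⟨n, ih⟩ := ih
      exact ⟨_, by rw [Multiset.add_cons]; exact ih.weakR⟩
  | cons A Γ' ih =>
    obtain ⟨n, ih⟩ := ih
    exact ⟨_, by rw [Multiset.add_cons]; exact ih.weakL⟩

theorem Provable.mono (h : Provable rs Γ Δ) {Γ' Δ' : Multiset (Form L)} (hΓ : Γ ≤ Γ')
    (hΔ : Δ ≤ Δ') : Provable rs Γ' Δ' := by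
  obtain ⟨Γ₁, rfl⟩ := Multiset.le_iff_exists_add.1 hΓ
  obtain ⟨Δ₁, rfl⟩ := Multiset.le_iff_exists_add.1 hΔ
  exact h.add _ _

theorem Provable.cut (h₁ : Provable rs (A ::ₘ Γ) Δ) (h₂ : Provable rs Γ (A ::ₘ Δ)) :
    Provable rs Γ Δ := by
  obtain ⟨n, h₁⟩ := h₁
  obtain ⟨m, h₂⟩ := h₂
  exact ⟨_, .cut rfl (.refl A) (.refl A) h₁ h₂⟩

theorem Provable.of_rwNegS (hr : RwNegS rs A B) (h : Provable rs (B ::ₘ Γ) Δ) :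
    Provable rs (A ::ₘ Γ) Δ := by
  obtain ⟨n, h⟩ := h
  exact ⟨_, .contrL hr hr (by rw [Multiset.cons_swap]; exact h.weakL)⟩

theorem Provable.of_rwPosS (hr : RwPosS rs A B) (h : Provable rs Γ (B ::ₘ Δ)) :
    Provable rs Γ (A ::ₘ Δ) := by
  obtain ⟨n, h⟩ := h
  exact ⟨_, .contrR hr hr h.weakR⟩

theorem Provable.notL (h : Provable rs Γ (A ::ₘ Δ)) : Provable rs (.not A ::ₘ Γ) Δ :=
  h.elim fun _ h => ⟨_, .notL (.refl _) h⟩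

theorem Provable.notR (h : Provable rs (A ::ₘ Γ) Δ) : Provable rs Γ (.not A ::ₘ Δ) :=
  h.elim fun _ h => ⟨_, .notR (.refl _) h⟩

theorem Provable.andL (h : Provable rs (A ::ₘ B ::ₘ Γ) Δ) :
    Provable rs (.and A B ::ₘ Γ) Δ :=
  h.elim fun _ h => ⟨_, .andL (.refl _) h⟩

theorem Provable.andR (h₁ : Provable rs Γ (A ::ₘ Δ)) (h₂ : Provable rs Γ (B ::ₘ Δ)) :
    Provable rs Γ (.and A B ::ₘ Δ) :=
  h₁.elim fun _ h₁ => h₂.elim fun _ h₂ => ⟨_, .andR (.refl _) h₁ h₂⟩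

theorem Provable.orL (h₁ : Provable rs (A ::ₘ Γ) Δ) (h₂ : Provable rs (B ::ₘ Γ) Δ) :
    Provable rs (.or A B ::ₘ Γ) Δ :=
  h₁.elim fun _ h₁ => h₂.elim fun _ h₂ => ⟨_, .orL (.refl _) h₁ h₂⟩

theorem Provable.orR (h : Provable rs Γ (A ::ₘ B ::ₘ Δ)) :
    Provable rs Γ (.or A B ::ₘ Δ) :=
  h.elim fun _ h => ⟨_, .orR (.refl _) h⟩

theorem Provable.impL (h₁ : Provable rs Γ (A ::ₘ Δ)) (h₂ : Provable rs (B ::ₘ Γ) Δ) :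
    Provable rs (.imp A B ::ₘ Γ) Δ :=
  h₁.elim fun _ h₁ => h₂.elim fun _ h₂ => ⟨_, .impL (.refl _) h₁ h₂⟩

theorem Provable.impR (h : Provable rs (A ::ₘ Γ) (B ::ₘ Δ)) :
    Provable rs Γ (.imp A B ::ₘ Δ) :=
  h.elim fun _ h => ⟨_, .impR (.refl _) h⟩

theorem Provable.allL {s : L.Sorts} (t : Term L s)
    (h : Provable rs (Form.inst t A ::ₘ Γ) Δ) : Provable rs (.all s A ::ₘ Γ) Δ :=
  h.elim fun _ h => ⟨_, .allL (.refl _) (.refl _) h⟩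

theorem Provable.allR {s : L.Sorts}
    (h : Provable rs (Γ.map (Form.shift s)) (A ::ₘ Δ.map (Form.shift s))) :
    Provable rs Γ (.all s A ::ₘ Δ) :=
  h.elim fun _ h => ⟨_, .allR (.refl _) h⟩

theorem Provable.exL {s : L.Sorts}
    (h : Provable rs (A ::ₘ Γ.map (Form.shift s)) (Δ.map (Form.shift s))) :
    Provable rs (.ex s A ::ₘ Γ) Δ :=
  h.elim fun _ h => ⟨_, .exL (.refl _) h⟩

theorem Provable.exR {s : L.Sorts} (t : Term L s)
    (h : Provable rs Γ (Form.inst t A ::ₘ Δ)) : Provable rs Γ (.ex s A ::ₘ Δ) :=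
  h.elim fun _ h => ⟨_, .exR (.refl _) (.refl _) h⟩

theorem Form.inst_var_zero_shift (s : L.Sorts) (A : Form L) :
    Form.inst (.var 0 : Term L s) (Form.rename (liftRen s (shiftRen s)) A) = A := by
  rw [Form.rename_eq_subst, ← liftSubst_var, Form.inst_subst_liftSubst]
  conv_rhs => rw [← Form.subst_var A]
  congr 1
  funext s' n
  by_cases h : s = s'
  · subst h; cases n <;> simp [pushSubst, shiftRen]
  · simp [pushSubst, shiftRen, h, Ne.symm h]

theorem Provable.identity_singleton (rs : PRS L) (A : Form L) : Provable rs {A} {A} := by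
  induction A with
  | pred p args => exact ⟨1, .ax (P := .pred p args) trivial (.refl _) (.refl _)⟩
  | bot => exact ⟨1, .botL (Γ := 0) (.refl _)⟩
  | top => exact ⟨1, .topR (Δ := 0) (.refl _)⟩
  | not A ih =>
    refine Provable.notR (Δ := 0) ?_
    rw [← Multiset.cons_zero, Multiset.cons_swap]
    exact Provable.notL (ih.mono (by simp) (by simp))
  | and A B ihA ihB =>
    exact Provable.andL (Γ := 0) (.andR (Δ := 0)
      (ihA.mono (by simp) (by simp)) (ihB.mono (by simp) (by simp)))
  | or A B ihA ihB =>
    exact Provable.orR (Δ := 0) (.orL (Γ := 0)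
      (ihA.mono (by simp) (by simp)) (ihB.mono (by simp) (by simp)))
  | imp A B ihA ihB =>
    refine Provable.impR (Δ := 0) ?_
    rw [← Multiset.cons_zero, Multiset.cons_swap]
    exact Provable.impL (ihA.mono (by simp) (by simp)) (ihB.mono (by simp) (by simp))
  | all s A ih =>
    refine Provable.allR (Δ := 0) ?_
    simp only [Multiset.map_singleton, Multiset.map_zero, Form.shift, Form.rename]
    refine Provable.allL (Γ := 0) (.var 0) ?_
    rw [Form.inst_var_zero_shift]
    exact ih
  | ex s A ih =>
    refine Provable.exL (Γ := 0) ?_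
    simp only [Multiset.map_singleton, Multiset.map_zero, Form.shift, Form.rename]
    refine Provable.exR (Δ := 0) (.var 0) ?_
    rw [Form.inst_var_zero_shift]
    exact ih

theorem Provable.identity (hΓ : A ∈ Γ) (hΔ : A ∈ Δ) : Provable rs Γ Δ :=
  (Provable.identity_singleton rs A).mono (Multiset.singleton_le.2 hΓ)
    (Multiset.singleton_le.2 hΔ)

end DerivedRules

theorem Term.toEq_subst (σ : (s : L.Sorts) → ℕ → Term L s) (s : L.Sorts) (t : Term L s) :
    Term.toEq s (Term.subst σ s t) =
      Term.subst (L := withEq L) (fun s n => Term.toEq (L := L) s (σ s n)) s (Term.toEq s t) := by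
  induction t with
  | var n => rfl
  | func f args ih => exact congrArg (Term.func (L := withEq L) f) (funext ih)

theorem Term.toEq_rename (ρ : (s : L.Sorts) → ℕ → ℕ) (s : L.Sorts) (t : Term L s) :
    Term.toEq s (Term.rename ρ s t) = Term.rename (L := withEq L) ρ s (Term.toEq s t) := by
  induction t with
  | var n => rfl
  | func f args ih => exact congrArg (Term.func (L := withEq L) f) (funext ih)

theorem toEq_liftSubst (s₀ : L.Sorts) (σ : (s : L.Sorts) → ℕ → Term L s) :
    (fun (s : L.Sorts) n => Term.toEq (L := L) s (liftSubst s₀ σ s n)) =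
      liftSubst (L := withEq L) s₀ fun s n => Term.toEq (L := L) s (σ s n) := by
  funext s n
  have e := fun m => Term.toEq_rename (shiftRen s₀) s (σ s m)
  by_cases h : s = s₀
  · subst h
    cases n with
    | zero =>
      exact (congrArg (Term.toEq (L := L) s) (liftSubst_zero s σ)).trans
        (liftSubst_zero (L := withEq L) s _).symm
    | succ n =>
      exact (congrArg (Term.toEq (L := L) s) (liftSubst_succ s σ n)).trans
        ((e n).trans (liftSubst_succ (L := withEq L) s
          (fun s n => Term.toEq (L := L) s (σ s n)) n).symm)
  · exact (congrArg (Term.toEq (L := L) s) (liftSubst_of_ne h σ n)).trans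
      ((e n).trans (liftSubst_of_ne (L := withEq L) h
        (fun s n => Term.toEq (L := L) s (σ s n)) n).symm)

theorem Form.toEq_subst (σ : (s : L.Sorts) → ℕ → Term L s) (A : Form L) :
    (Form.subst σ A).toEq =
      Form.subst (L := withEq L) (fun s n => Term.toEq (L := L) s (σ s n)) A.toEq := by
  induction A generalizing σ with
  | pred p args =>
    exact congrArg (Form.pred (L := withEq L) (.inl p))
      (funext fun i => Term.toEq_subst σ _ (args i))
  | bot => rfl
  | top => rfl
  | not A ih => simp only [Form.subst, Form.toEq, ih]
  | and A B ihA ihB => simp only [Form.subst, Form.toEq, ihA, ihB]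
  | or A B ihA ihB => simp only [Form.subst, Form.toEq, ihA, ihB]
  | imp A B ihA ihB => simp only [Form.subst, Form.toEq, ihA, ihB]
  | all s A ih =>
    exact congrArg (Form.all (L := withEq L) s) ((ih _).trans
      (congrArg (fun τ => Form.subst (L := withEq L) τ A.toEq) (toEq_liftSubst s σ)))
  | ex s A ih =>
    exact congrArg (Form.ex (L := withEq L) s) ((ih _).trans
      (congrArg (fun τ => Form.subst (L := withEq L) τ A.toEq) (toEq_liftSubst s σ)))

theorem Form.toEq_shift (s : L.Sorts) (A : Form L) :
    (Form.shift s A).toEq = Form.shift (L := withEq L) s A.toEq := by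
  unfold Form.shift
  rw [Form.rename_eq_subst, Form.rename_eq_subst, Form.toEq_subst]
  rfl

theorem Form.toEq_inst {s : L.Sorts} (t : Term L s) (A : Form L) :
    (Form.inst t A).toEq = Form.inst (L := withEq L) (s := s) (Term.toEq s t) A.toEq := by
  unfold Form.inst
  rw [Form.toEq_subst]
  congr 1
  funext s' n
  by_cases h : s = s'
  · subst h
    cases n with
    | zero =>
      exact (congrArg (Term.toEq (L := L) s) (pushSubst_zero _ t)).trans
        (pushSubst_zero (L := withEq L) (s := s) _ _).symm
    | succ n =>
      exact (congrArg (Term.toEq (L := L) s) (pushSubst_succ _ t n)).trans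
        (pushSubst_succ (L := withEq L) (s := s) _ (Term.toEq s t) n).symm
  · exact (congrArg (Term.toEq (L := L) s') (pushSubst_of_ne h _ t n)).trans
      (pushSubst_of_ne (L := withEq L) h _ _ n).symm

theorem EqE.toEq {rs : PRS L} {s : L.Sorts} {t u : Term L s} (h : EqE rs s t u) :
    EqE rs.toEq s (Term.toEq s t) (Term.toEq s u) := by
  induction h with
  | base σ h =>
    rw [Term.toEq_subst, Term.toEq_subst]
    exact EqE.base (rs := rs.toEq) _ ⟨_, _, h, rfl, rfl⟩
  | refl t => exact .refl _
  | symm _ ih => exact .symm ih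
  | trans _ _ ih₁ ih₂ => exact .trans ih₁ ih₂
  | congr f _ ih => exact EqE.congr (rs := rs.toEq) f ih

mutual
theorem RwNeg.toEq {rs : PRS L} {A B : Form L} : RwNeg rs A B → RwNeg rs.toEq A.toEq B.toEq
  | .predArg p args args' i h hj =>
      .predArg (L := withEq L) (.inl p) _ _ i h.toEq fun j hne =>
        congrArg (Term.toEq (L := L) _) (hj j hne)
  | .rule τ h => by
      rw [Form.toEq_subst, Form.toEq_subst]
      exact RwNeg.rule (rs := rs.toEq) _ ⟨_, _, h, rfl, rfl⟩
  | .notC h => .notC h.toEq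
  | .andL h => .andL h.toEq
  | .andR h => .andR h.toEq
  | .orL h => .orL h.toEq
  | .orR h => .orR h.toEq
  | .impL h => .impL h.toEq
  | .impR h => .impR h.toEq
  | .allC h => .allC h.toEq
  | .exC h => .exC h.toEq
theorem RwPos.toEq {rs : PRS L} {A B : Form L} : RwPos rs A B → RwPos rs.toEq A.toEq B.toEq
  | .predArg p args args' i h hj =>
      .predArg (L := withEq L) (.inl p) _ _ i h.toEq fun j hne =>
        congrArg (Term.toEq (L := L) _) (hj j hne)
  | .rule τ h => by
      rw [Form.toEq_subst, Form.toEq_subst]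
      exact RwPos.rule (rs := rs.toEq) _ ⟨_, _, h, rfl, rfl⟩
  | .notC h => .notC h.toEq
  | .andL h => .andL h.toEq
  | .andR h => .andR h.toEq
  | .orL h => .orL h.toEq
  | .orR h => .orR h.toEq
  | .impL h => .impL h.toEq
  | .impR h => .impR h.toEq
  | .allC h => .allC h.toEq
  | .exC h => .exC h.toEq
end

theorem RwNegS.toEq {rs : PRS L} {A B : Form L} (h : RwNegS rs A B) :
    RwNegS rs.toEq A.toEq B.toEq :=
  Relation.ReflTransGen.lift Form.toEq (fun _ _ h => h.toEq) _ _ h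

theorem RwPosS.toEq {rs : PRS L} {A B : Form L} (h : RwPosS rs A B) :
    RwPosS rs.toEq A.toEq B.toEq :=
  Relation.ReflTransGen.lift Form.toEq (fun _ _ h => h.toEq) _ _ h

theorem Form.IsAtomic.toEq {A : Form L} (h : A.IsAtomic) : A.toEq.IsAtomic := by
  cases A <;> simp_all [Form.IsAtomic, Form.toEq]

theorem map_toEq_shift (s : L.Sorts) (Γ : Multiset (Form L)) :
    (Γ.map (Form.shift s)).map Form.toEq =
      (Γ.map Form.toEq).map (Form.shift (L := withEq L) s) := by
  simp only [Multiset.map_map, Function.comp_def, Form.toEq_shift]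

theorem Pf.toEq {rs : PRS L} {c : Bool} {n : ℕ} {Γ Δ : Multiset (Form L)}
    (h : Pf rs c n Γ Δ) : Pf rs.toEq c n (Γ.map Form.toEq) (Δ.map Form.toEq) := by
  induction h with
  | ax hP h₁ h₂ => exact .ax hP.toEq h₁.toEq h₂.toEq
  | cut hc h₁ h₂ _ _ ih₁ ih₂ =>
    simp only [Multiset.map_cons] at ih₁ ih₂ ⊢
    exact .cut hc h₁.toEq h₂.toEq ih₁ ih₂
  | contrL h₁ h₂ _ ih =>
    simp only [Multiset.map_cons] at ih ⊢
    exact .contrL h₁.toEq h₂.toEq ih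
  | contrR h₁ h₂ _ ih =>
    simp only [Multiset.map_cons] at ih ⊢
    exact .contrR h₁.toEq h₂.toEq ih
  | weakL _ ih => rw [Multiset.map_cons]; exact .weakL ih
  | weakR _ ih => rw [Multiset.map_cons]; exact .weakR ih
  | topR h => rw [Multiset.map_cons]; exact .topR h.toEq
  | botL h => rw [Multiset.map_cons]; exact .botL h.toEq
  | notL h _ ih =>
    simp only [Multiset.map_cons] at ih ⊢
    exact .notL h.toEq ih
  | notR h _ ih =>
    simp only [Multiset.map_cons] at ih ⊢
    exact .notR h.toEq ih
  | andL h _ ih =>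
    simp only [Multiset.map_cons] at ih ⊢
    exact .andL h.toEq ih
  | andR h _ _ ih₁ ih₂ =>
    simp only [Multiset.map_cons] at ih₁ ih₂ ⊢
    exact .andR h.toEq ih₁ ih₂
  | orL h _ _ ih₁ ih₂ =>
    simp only [Multiset.map_cons] at ih₁ ih₂ ⊢
    exact .orL h.toEq ih₁ ih₂
  | orR h _ ih =>
    simp only [Multiset.map_cons] at ih ⊢
    exact .orR h.toEq ih
  | impL h _ _ ih₁ ih₂ =>
    simp only [Multiset.map_cons] at ih₁ ih₂ ⊢
    exact .impL h.toEq ih₁ ih₂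
  | impR h _ ih =>
    simp only [Multiset.map_cons] at ih ⊢
    exact .impR h.toEq ih
  | allL h₁ h₂ _ ih =>
    have h₂ := h₂.toEq
    rw [Form.toEq_inst] at h₂
    simp only [Multiset.map_cons] at ih ⊢
    exact .allL h₁.toEq h₂ ih
  | allR h _ ih =>
    simp only [Multiset.map_cons, map_toEq_shift] at ih ⊢
    exact .allR h.toEq ih
  | exL h _ ih =>
    simp only [Multiset.map_cons, map_toEq_shift] at ih ⊢
    exact .exL h.toEq ih
  | exR h₁ h₂ _ ih =>
    have h₂ := h₂.toEq
    rw [Form.toEq_inst] at h₂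
    simp only [Multiset.map_cons] at ih ⊢
    exact .exR h₁.toEq h₂ ih

theorem Provable.toEq {rs : PRS L} {Γ Δ : Multiset (Form L)} (h : Provable rs Γ Δ) :
    Provable rs.toEq (Γ.map Form.toEq) (Δ.map Form.toEq) :=
  h.imp fun _ h => h.toEq

/-- The substitution that renames the variable `y` of sort `s` to `0` and shifts the other
variables of sort `s`. -/
def captureSubst (s : L.Sorts) (y : ℕ) : (s : L.Sorts) → ℕ → Term L s :=
  fun s' n => if s' = s ∧ n = y then .var 0 else .var (shiftRen s s' n)

theorem captureSubst_of_lt (s : L.Sorts) {y : ℕ} (s' : L.Sorts) {n : ℕ} (h : n < y) :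
    captureSubst s y s' n = .var (shiftRen s s' n) := by
  simp [captureSubst, h.ne]

theorem exists_captureSubst_eq_shift (s : L.Sorts) (Γ : Multiset (Form L)) :
    ∃ N : ℕ, ∀ y ≥ N, Γ.map (Form.subst (captureSubst s y)) = Γ.map (Form.shift s) := by
  obtain ⟨N, hN⟩ := exists_subst_congr_bound_multiset Γ
  refine ⟨N, fun y hy => Multiset.map_congr rfl fun A hA => ?_⟩
  rw [Form.shift, Form.rename_eq_subst]
  exact hN A hA _ _ fun s' n hn => captureSubst_of_lt s s' (hn.trans_le hy)

theorem exists_captureSubst_inst_eq (s : L.Sorts) (A : Form L) :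
    ∃ N : ℕ, ∀ y ≥ N,
      Form.subst (captureSubst s y) (Form.inst (.var y : Term L s) A) = A := by
  obtain ⟨N, hN⟩ := A.exists_subst_congr_bound
  refine ⟨N, fun y hy => ?_⟩
  rw [Form.subst_inst, Form.inst_subst_liftSubst]
  conv_rhs => rw [← Form.subst_var A]
  refine hN _ _ fun s' n hn => ?_
  have e : Term.subst (captureSubst s y) s (.var y) = .var 0 := by
    simp [Term.subst, captureSubst]
  rw [e]
  by_cases h : s = s'
  · subst h
    cases n with
    | zero => rw [pushSubst_zero]
    | succ n =>
      rw [pushSubst_succ, captureSubst_of_lt s s (by omega)]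
      simp [shiftRen]
  · rw [pushSubst_of_ne h, captureSubst_of_lt s s' (by omega)]
    simp [shiftRen, Ne.symm h]

section FreshVariables

variable {rs : PRS L} {Γ Δ : Multiset (Form L)} {s : L.Sorts} {A : Form L}

theorem Provable.allR_of_forall_inst
    (h : ∀ t : Term L s, Provable rs Γ (Form.inst t A ::ₘ Δ)) :
    Provable rs Γ (.all s A ::ₘ Δ) := by
  obtain ⟨N₁, h₁⟩ := exists_captureSubst_eq_shift s Γ
  obtain ⟨N₂, h₂⟩ := exists_captureSubst_eq_shift s Δ
  obtain ⟨N₃, h₃⟩ := exists_captureSubst_inst_eq s A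
  have h := (h (.var (N₁ + N₂ + N₃))).subst (captureSubst s (N₁ + N₂ + N₃))
  rw [Multiset.map_cons, h₁ _ (by omega), h₂ _ (by omega), h₃ _ (by omega)] at h
  exact h.allR

theorem Provable.exL_of_forall_inst
    (h : ∀ t : Term L s, Provable rs (Form.inst t A ::ₘ Γ) Δ) :
    Provable rs (.ex s A ::ₘ Γ) Δ := by
  obtain ⟨N₁, h₁⟩ := exists_captureSubst_eq_shift s Γ
  obtain ⟨N₂, h₂⟩ := exists_captureSubst_eq_shift s Δ
  obtain ⟨N₃, h₃⟩ := exists_captureSubst_inst_eq s A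
  have h := (h (.var (N₁ + N₂ + N₃))).subst (captureSubst s (N₁ + N₂ + N₃))
  rw [Multiset.map_cons, h₁ _ (by omega), h₂ _ (by omega), h₃ _ (by omega)] at h
  exact h.exL

end FreshVariables

/-- Sequents of `L`, the conditions of the forcing interpretation. -/
abbrev Ctx (L : Language) : Type := Multiset (Form L) × Multiset (Form L)

/-- The negation of a forcing value: no extension forces it, unless it is provable. -/
def ctxNeg (rs : PRS L) (X : Ctx L → Prop) (w : Ctx L) : Prop :=
  ∀ v ≥ w, X v → Provable rs v.1 v.2

/-- Forcing values: the sets of conditions closed under extension and double negation. -/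
structure IsRegular (rs : PRS L) (X : Ctx L → Prop) : Prop where
  mono : ∀ {v w : Ctx L}, w ≤ v → X w → X v
  of_neg_neg : ∀ {w : Ctx L}, ctxNeg rs (ctxNeg rs X) w → X w

section Regular

variable {rs : PRS L} {X Y : Ctx L → Prop} {w : Ctx L}

theorem ctxNeg.mono {v : Ctx L} (hv : w ≤ v) (h : ctxNeg rs X w) : ctxNeg rs X v :=
  fun u hu => h u (hv.trans hu)

theorem ctxNeg.antitone (h : ctxNeg rs Y w) (hXY : ∀ v, X v → Y v) : ctxNeg rs X w :=
  fun v hv hx => h v hv (hXY v hx)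

theorem isRegular_ctxNeg (hX : ∀ {v w : Ctx L}, w ≤ v → X w → X v) :
    IsRegular rs (ctxNeg rs X) where
  mono := ctxNeg.mono
  of_neg_neg h v hv hx := h v hv fun u hu hn => hn u le_rfl (hX hu hx)

theorem isRegular_provable (rs : PRS L) : IsRegular rs fun w => Provable rs w.1 w.2 where
  mono hv h := h.mono hv.1 hv.2
  of_neg_neg h := h _ le_rfl fun _ _ => id

theorem isRegular_provable_cons (rs : PRS L) (A : Form L) :
    IsRegular rs fun w => Provable rs w.1 (A ::ₘ w.2) where
  mono hv h := h.mono hv.1 (Multiset.cons_le_cons _ hv.2)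
  of_neg_neg {w} h := h (w.1, A ::ₘ w.2) ⟨le_rfl, Multiset.le_cons_self _ _⟩ fun v hv hx =>
    Provable.cut (Provable.identity (A := A) (by simp)
      (Multiset.mem_of_le hv.2 (by simp))) hx

theorem ctxNeg_provable_cons {A : Form L} :
    ctxNeg rs (fun w => Provable rs w.1 (A ::ₘ w.2)) w ↔ Provable rs (A ::ₘ w.1) w.2 := by
  refine ⟨fun h => ?_, fun h v hv hA => ?_⟩
  · exact h (A ::ₘ w.1, w.2) ⟨Multiset.le_cons_self _ _, le_rfl⟩
      (Provable.identity (A := A) (by simp) (by simp))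
  · exact Provable.cut (h.mono (Multiset.cons_le_cons _ hv.1) hv.2) hA

end Regular

/-- The value in `L` of a term of `withEq L`. -/
def Term.evalEq (σ : (s : L.Sorts) → ℕ → Term L s) :
    (s : L.Sorts) → Term (withEq L) s → Term L s
  | s, .var n => σ s n
  | _, .func f args => Term.func (L := L) f fun i => Term.evalEq σ _ (args i)

/-- The forcing interpretation of the propositions of `withEq L`. -/
def Form.force (rs : PRS L) : ((s : L.Sorts) → ℕ → Term L s) → Form (withEq L) → Ctx L → Prop
  | σ, .pred (.inl p) args => fun w =>
      Provable rs w.1 (Form.pred (L := L) p (fun i => Term.evalEq (L := L) σ _ (args i)) ::ₘ w.2)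
  | σ, .pred (.inr s) args => fun w =>
      EqE rs s (Term.evalEq (L := L) σ s (args ⟨0, Nat.zero_lt_two⟩))
        (Term.evalEq (L := L) σ s (args ⟨1, Nat.one_lt_two⟩)) ∨ Provable rs w.1 w.2
  | _, .bot => fun w => Provable rs w.1 w.2
  | _, .top => fun _ => True
  | σ, .not A => ctxNeg rs (Form.force rs σ A)
  | σ, .and A B => fun w => Form.force rs σ A w ∧ Form.force rs σ B w
  | σ, .or A B => ctxNeg rs fun w =>
      ctxNeg rs (Form.force rs σ A) w ∧ ctxNeg rs (Form.force rs σ B) w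
  | σ, .imp A B => ctxNeg rs fun w => Form.force rs σ A w ∧ ctxNeg rs (Form.force rs σ B) w
  | σ, .all s A => fun w => ∀ t : Term L s, Form.force rs (pushSubst σ t) A w
  | σ, .ex s A => ctxNeg rs fun w =>
      ∀ t : Term L s, ctxNeg rs (Form.force rs (pushSubst σ t) A) w

theorem Form.isRegular_force (rs : PRS L) (A : Form (withEq L))
    (σ : (s : L.Sorts) → ℕ → Term L s) : IsRegular rs (Form.force rs σ A) := by
  induction A generalizing σ with
  | pred p args =>
    rcases p with p | s
    · exact isRegular_provable_cons rs _
    · refine ⟨fun hv h => h.imp id fun h => h.mono hv.1 hv.2, fun {w} h => ?_⟩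
      by_cases e : EqE rs s (Term.evalEq (L := L) σ s (args ⟨0, Nat.zero_lt_two⟩))
        (Term.evalEq (L := L) σ s (args ⟨1, Nat.one_lt_two⟩))
      · exact .inl e
      · exact .inr (h w le_rfl fun v _ hx => hx.resolve_left e)
  | bot => exact isRegular_provable rs
  | top => exact ⟨fun _ _ => trivial, fun _ => trivial⟩
  | not A ih => exact isRegular_ctxNeg (ih σ).mono
  | and A B ihA ihB =>
    refine ⟨fun hv h => ⟨(ihA σ).mono hv h.1, (ihB σ).mono hv h.2⟩, fun h => ⟨?_, ?_⟩⟩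
    · exact (ihA σ).of_neg_neg (h.antitone fun v hv => hv.antitone fun u hu => hu.1)
    · exact (ihB σ).of_neg_neg (h.antitone fun v hv => hv.antitone fun u hu => hu.2)
  | or A B ihA ihB => exact isRegular_ctxNeg fun hv h => ⟨h.1.mono hv, h.2.mono hv⟩
  | imp A B ihA ihB =>
    exact isRegular_ctxNeg fun hv h => ⟨(ihA σ).mono hv h.1, h.2.mono hv⟩
  | all s A ih =>
    refine ⟨fun hv h t => (ih _).mono hv (h t), fun h t => ?_⟩
    exact (ih _).of_neg_neg (h.antitone fun v hv => hv.antitone fun u hu => hu t)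
  | ex s A ih => exact isRegular_ctxNeg fun hv h t => (h t).mono hv

theorem Term.evalEq_subst (σ : (s : L.Sorts) → ℕ → Term L s)
    (τ : (s : L.Sorts) → ℕ → Term (withEq L) s) : ∀ (s : L.Sorts) (t : Term (withEq L) s),
    Term.evalEq (L := L) σ s (Term.subst (L := withEq L) τ s t) =
      Term.evalEq (L := L) (fun s n => Term.evalEq (L := L) σ s (τ s n)) s t
  | _, .var _ => rfl
  | _, .func f args => congrArg (Term.func (L := L) f)
      (funext fun i => Term.evalEq_subst σ τ _ (args i))

theorem Term.evalEq_toEq (σ : (s : L.Sorts) → ℕ → Term L s) (s : L.Sorts) (t : Term L s) :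
    Term.evalEq σ s (Term.toEq s t) = Term.subst σ s t := by
  induction t with
  | var n => rfl
  | func f args ih => exact congrArg (Term.func (L := L) f) (funext ih)

theorem Term.evalEq_pushSubst_shift {s₀ : L.Sorts} (σ : (s : L.Sorts) → ℕ → Term L s)
    (d : Term L s₀) (s : L.Sorts) (t : Term (withEq L) s) :
    Term.evalEq (L := L) (pushSubst σ d) s
      (Term.rename (L := withEq L) (shiftRen (L := withEq L) s₀) s t) =
      Term.evalEq (L := L) σ s t := by
  refine (congrArg (Term.evalEq (L := L) (pushSubst σ d) s)
    (Term.rename_eq_subst (L := withEq L) _ s t)).trans ((Term.evalEq_subst _ _ s t).trans ?_)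
  exact congrArg (fun σ => Term.evalEq (L := L) σ s t)
    (funext fun s' => funext fun n => pushSubst_shiftRen σ d s' n)

theorem evalEq_pushSubst_liftSubst {s₀ : L.Sorts} (σ : (s : L.Sorts) → ℕ → Term L s)
    (τ : (s : L.Sorts) → ℕ → Term (withEq L) s) (d : Term L s₀) :
    (fun s n => Term.evalEq (L := L) (pushSubst σ d) s (liftSubst (L := withEq L) s₀ τ s n)) =
      pushSubst (fun s n => Term.evalEq (L := L) σ s (τ s n)) d := by
  funext s n
  by_cases h : s = s₀
  · subst h
    cases n with
    | zero =>
      exact (congrArg (Term.evalEq (L := L) (pushSubst σ d) s)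
        (liftSubst_zero (L := withEq L) s τ)).trans
          ((pushSubst_zero σ d).trans (pushSubst_zero _ d).symm)
    | succ n =>
      exact (congrArg (Term.evalEq (L := L) (pushSubst σ d) s)
        (liftSubst_succ (L := withEq L) s τ n)).trans
          ((Term.evalEq_pushSubst_shift σ d s (τ s n)).trans
            (pushSubst_succ (fun s n => Term.evalEq (L := L) σ s (τ s n)) d n).symm)
  · exact (congrArg (Term.evalEq (L := L) (pushSubst σ d) s)
      (liftSubst_of_ne (L := withEq L) h τ n)).trans
        ((Term.evalEq_pushSubst_shift σ d s (τ s n)).trans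
          (pushSubst_of_ne (Ne.symm h)
            (fun s n => Term.evalEq (L := L) σ s (τ s n)) d n).symm)

theorem Form.force_subst (rs : PRS L) (σ : (s : L.Sorts) → ℕ → Term L s)
    (τ : (s : L.Sorts) → ℕ → Term (withEq L) s) (A : Form (withEq L)) :
    Form.force rs σ (Form.subst (L := withEq L) τ A) =
      Form.force rs (fun s n => Term.evalEq (L := L) σ s (τ s n)) A := by
  induction A generalizing σ τ with
  | pred p args =>
    have e := fun i => Term.evalEq_subst σ τ _ (args i)
    rcases p with p | s
    · exact congrArg (fun a (w : Ctx L) => Provable rs w.1 (Form.pred (L := L) p a ::ₘ w.2))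
        (funext e)
    · exact congrArg₂ (fun t u (w : Ctx L) => EqE rs s t u ∨ Provable rs w.1 w.2)
        (e ⟨0, Nat.zero_lt_two⟩) (e ⟨1, Nat.one_lt_two⟩)
  | bot => rfl
  | top => rfl
  | not A ih => simp only [Form.subst, Form.force, ih]
  | and A B ihA ihB => simp only [Form.subst, Form.force, ihA, ihB]
  | or A B ihA ihB => simp only [Form.subst, Form.force, ihA, ihB]
  | imp A B ihA ihB => simp only [Form.subst, Form.force, ihA, ihB]
  | all s A ih =>
    have e : ∀ t : Term L s, Form.force rs (pushSubst σ t)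
        (Form.subst (L := withEq L) (liftSubst (L := withEq L) s τ) A) = _ :=
      fun t => (ih _ _).trans (congrArg (fun σ => Form.force rs σ A)
        (evalEq_pushSubst_liftSubst σ τ t))
    simp only [Form.subst, Form.force, e]
  | ex s A ih =>
    have e : ∀ t : Term L s, Form.force rs (pushSubst σ t)
        (Form.subst (L := withEq L) (liftSubst (L := withEq L) s τ) A) = _ :=
      fun t => (ih _ _).trans (congrArg (fun σ => Form.force rs σ A)
        (evalEq_pushSubst_liftSubst σ τ t))
    simp only [Form.subst, Form.force, e]

theorem Form.force_shift (rs : PRS L) {s : L.Sorts} (σ : (s : L.Sorts) → ℕ → Term L s)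
    (t : Term L s) (A : Form (withEq L)) :
    Form.force rs (pushSubst σ t) (Form.shift (L := withEq L) s A) = Form.force rs σ A := by
  unfold Form.shift
  rw [Form.rename_eq_subst]
  refine (Form.force_subst rs (pushSubst σ t) _ A).trans ?_
  exact congrArg (fun σ => Form.force rs σ A)
    (funext fun s' => funext fun n => pushSubst_shiftRen σ t s' n)

theorem Form.force_inst (rs : PRS L) {s : L.Sorts} (σ : (s : L.Sorts) → ℕ → Term L s)
    (t : Term (withEq L) s) (A : Form (withEq L)) :
    Form.force rs σ (Form.inst (L := withEq L) (s := s) t A) =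
      Form.force rs (pushSubst σ (Term.evalEq (L := L) σ s t)) A := by
  refine (Form.force_subst rs σ _ A).trans ?_
  refine congrArg (fun σ => Form.force rs σ A) (funext fun s' => funext fun n => ?_)
  by_cases h : s = s'
  · subst h
    cases n with
    | zero =>
      exact (congrArg (Term.evalEq (L := L) σ s)
        (pushSubst_zero (L := withEq L) (s := s) _ t)).trans (pushSubst_zero σ _).symm
    | succ n =>
      exact (congrArg (Term.evalEq (L := L) σ s)
        (pushSubst_succ (L := withEq L) (s := s) _ t n)).trans (pushSubst_succ σ _ n).symm
  · exact (congrArg (Term.evalEq (L := L) σ s')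
      (pushSubst_of_ne (L := withEq L) h _ t n)).trans (pushSubst_of_ne h σ _ n).symm

theorem Form.force_toEq (rs : PRS L) (A : Form L) (σ : (s : L.Sorts) → ℕ → Term L s) :
    Form.force rs σ A.toEq = fun w => Provable rs w.1 (Form.subst σ A ::ₘ w.2) := by
  induction A generalizing σ with
  | pred p args =>
    exact congrArg (fun a (w : Ctx L) => Provable rs w.1 (Form.pred (L := L) p a ::ₘ w.2))
      (funext fun i => Term.evalEq_toEq σ _ (args i))
  | bot =>
    funext w
    refine propext ⟨fun h => h.mono le_rfl (Multiset.le_cons_self _ _), fun h => ?_⟩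
    exact Provable.cut ⟨1, .botL (.refl _)⟩ h
  | top => exact funext fun w => propext ⟨fun _ => ⟨1, .topR (.refl _)⟩, fun _ => trivial⟩
  | not A ih =>
    funext w
    simp only [Form.toEq, Form.force, Form.subst, ih, ctxNeg_provable_cons]
    refine propext ⟨fun h => h.notR, fun h => ?_⟩
    exact Provable.cut (.notL (Provable.identity (A := Form.subst σ A) (by simp) (by simp)))
      (h.mono (Multiset.le_cons_self _ _) le_rfl)
  | and A B ihA ihB =>
    funext w
    simp only [Form.toEq, Form.force, Form.subst, ihA, ihB]
    refine propext ⟨fun h => h.1.andR h.2, fun h => ⟨?_, ?_⟩⟩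
    · refine Provable.cut (A := .and (Form.subst σ A) (Form.subst σ B)) (Provable.andL
        (Provable.identity (A := Form.subst σ A) (by simp) (by simp))) ?_
      exact h.mono le_rfl (Multiset.cons_le_cons _ (Multiset.le_cons_self _ _))
    · refine Provable.cut (A := .and (Form.subst σ A) (Form.subst σ B)) (Provable.andL
        (Provable.identity (A := Form.subst σ B) (by simp) (by simp))) ?_
      exact h.mono le_rfl (Multiset.cons_le_cons _ (Multiset.le_cons_self _ _))
  | or A B ihA ihB =>
    funext w
    simp only [Form.toEq, Form.force, Form.subst, ihA, ihB, ctxNeg_provable_cons]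
    refine propext ⟨fun h => Provable.orR ?_, fun h v hv hn => ?_⟩
    · refine h (w.1, Form.subst σ A ::ₘ Form.subst σ B ::ₘ w.2) ⟨le_rfl, ?_⟩ ⟨?_, ?_⟩
      · exact (Multiset.le_cons_self _ _).trans (Multiset.le_cons_self _ _)
      · exact Provable.identity (A := Form.subst σ A) (by simp) (by simp)
      · exact Provable.identity (A := Form.subst σ B) (by simp) (by simp)
    · exact Provable.cut (hn.1.orL hn.2) (h.mono hv.1 (Multiset.cons_le_cons _ hv.2))
  | imp A B ihA ihB =>
    funext w
    simp only [Form.toEq, Form.force, Form.subst, ihA, ihB, ctxNeg_provable_cons]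
    refine propext ⟨fun h => Provable.impR ?_, fun h v hv hn => ?_⟩
    · refine h (Form.subst σ A ::ₘ w.1, Form.subst σ B ::ₘ w.2)
        ⟨Multiset.le_cons_self _ _, Multiset.le_cons_self _ _⟩ ⟨?_, ?_⟩
      · exact Provable.identity (A := Form.subst σ A) (by simp) (by simp)
      · exact Provable.identity (A := Form.subst σ B) (by simp) (by simp)
    · exact Provable.cut (hn.1.impL hn.2) (h.mono hv.1 (Multiset.cons_le_cons _ hv.2))
  | all s A ih =>
    funext w
    simp only [Form.toEq, Form.force, Form.subst, ih, ← Form.inst_subst_liftSubst]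
    refine propext ⟨Provable.allR_of_forall_inst, fun h t => ?_⟩
    refine Provable.cut (A := .all s (Form.subst (liftSubst s σ) A)) (.allL t
      (Provable.identity (A := Form.inst t (Form.subst (liftSubst s σ) A)) (by simp) (by simp))) ?_
    exact h.mono le_rfl (Multiset.cons_le_cons _ (Multiset.le_cons_self _ _))
  | ex s A ih =>
    funext w
    simp only [Form.toEq, Form.force, Form.subst, ih, ← Form.inst_subst_liftSubst,
      ctxNeg_provable_cons]
    refine propext ⟨fun h => ?_, fun h v hv hn => ?_⟩
    · refine h (w.1, .ex s (Form.subst (liftSubst s σ) A) ::ₘ w.2)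
        ⟨le_rfl, Multiset.le_cons_self _ _⟩ fun t => Provable.exR t ?_
      exact Provable.identity (A := Form.inst t (Form.subst (liftSubst s σ) A))
        (by simp) (by simp)
    · exact Provable.cut (Provable.exL_of_forall_inst hn)
        (h.mono hv.1 (Multiset.cons_le_cons _ hv.2))

theorem RwPosS.predArgs {rs : PRS L} {p : L.Pred}
    {args args' : (i : Fin (L.parity p).length) → Term L ((L.parity p).get i)}
    (h : ∀ i, EqE rs _ (args i) (args' i)) : RwPosS rs (.pred p args) (.pred p args') := by
  have key : ∀ S : Finset (Fin (L.parity p).length),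
      RwPosS rs (.pred p args) (.pred p fun i => if i ∈ S then args' i else args i) := by
    intro S
    induction S using Finset.induction_on with
    | empty => simpa using RwPosS.refl _
    | insert i S hi ih =>
      refine ih.tail (.predArg p _ _ i ?_ fun j hj => ?_)
      · simpa [hi] using h i
      · simp [hj]
  simpa using key Finset.univ

theorem EqE.evalEq {rs : PRS L} (σ : (s : L.Sorts) → ℕ → Term L s) {s : (withEq L).Sorts}
    {t u : Term (withEq L) s} (h : EqE rs.toEq s t u) :
    EqE rs s (Term.evalEq (L := L) σ s t) (Term.evalEq (L := L) σ s u) := by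
  induction h with
  | @base s t u τ h =>
    obtain ⟨t₀, u₀, h, rfl, rfl⟩ := h
    have e : ∀ t₀ : Term L s,
        Term.evalEq (L := L) σ s (Term.subst (L := withEq L) τ s (Term.toEq (L := L) s t₀)) =
          Term.subst (fun s n => Term.evalEq (L := L) σ s (τ s n)) s t₀ :=
      fun t₀ => (Term.evalEq_subst σ τ s _).trans (Term.evalEq_toEq (L := L) _ s t₀)
    exact (congrArg₂ (EqE rs s) (e t₀) (e u₀)).mpr (EqE.base _ h)
  | refl t => exact .refl _
  | symm _ ih => exact .symm ih
  | trans _ _ ih₁ ih₂ => exact .trans ih₁ ih₂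
  | congr f _ ih => exact EqE.congr (rs := rs) f ih

theorem Form.force_subst_toEq (rs : PRS L) (σ : (s : L.Sorts) → ℕ → Term L s)
    (τ : (s : L.Sorts) → ℕ → Term (withEq L) s) (A : Form L) (w : Ctx L) :
    Form.force rs σ (Form.subst (L := withEq L) τ A.toEq) w ↔ Provable rs w.1
      (Form.subst (fun s n => Term.evalEq (L := L) σ s (τ s n)) A ::ₘ w.2) :=
  (congrFun ((Form.force_subst rs σ τ A.toEq).trans (Form.force_toEq rs A _)) w).to_iff

theorem Form.force_pred_congr {rs : PRS L} {σ : (s : L.Sorts) → ℕ → Term L s}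
    {p : (withEq L).Pred} {args args' : (i : Fin ((withEq L).parity p).length) →
      Term (withEq L) (((withEq L).parity p).get i)}
    (h : ∀ i, EqE rs _ (Term.evalEq (L := L) σ _ (args i)) (Term.evalEq (L := L) σ _ (args' i)))
    {w : Ctx L} (hw : Form.force rs σ (.pred p args) w) : Form.force rs σ (.pred p args') w := by
  rcases p with p | s
  · exact Provable.of_rwPosS (RwPosS.predArgs (L := L) fun i => (h i).symm) hw
  · exact hw.imp_left fun e =>
      (h ⟨0, Nat.zero_lt_two⟩).symm.trans (e.trans (h ⟨1, Nat.one_lt_two⟩))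

theorem Form.force_predArg {rs : PRS L} {p : (withEq L).Pred}
    {args args' : (i : Fin ((withEq L).parity p).length) →
      Term (withEq L) (((withEq L).parity p).get i)}
    {i : Fin ((withEq L).parity p).length} (hi : EqE rs.toEq _ (args i) (args' i))
    (hj : ∀ j, j ≠ i → args j = args' j) (σ : (s : L.Sorts) → ℕ → Term L s) (j) :
    EqE rs _ (Term.evalEq (L := L) σ _ (args j)) (Term.evalEq (L := L) σ _ (args' j)) := by
  by_cases h : j = i
  · subst h
    exact hi.evalEq σ
  · rw [hj j h]
    exact .refl _

mutual
theorem RwNeg.force {rs : PRS L} {A B : Form (withEq L)} :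
    RwNeg rs.toEq A B → ∀ (σ : (s : L.Sorts) → ℕ → Term L s) (w : Ctx L),
      Form.force rs σ A w → Form.force rs σ B w
  | .predArg p args args' i h hj, σ, w => Form.force_pred_congr (Form.force_predArg h hj σ)
  | .rule τ h, σ, w => by
      obtain ⟨P₀, A₀, h, rfl, rfl⟩ := h
      refine fun hw => (Form.force_subst_toEq rs σ τ A₀ w).mpr ?_
      have hw := (Form.force_subst_toEq rs σ τ P₀ w).mp hw
      refine Provable.cut (Provable.of_rwNegS (.single (.rule _ h)) (Provable.identity (A := _)
        (Multiset.mem_cons_self _ _) (Multiset.mem_cons_self _ _))) (hw.mono le_rfl ?_)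
      exact Multiset.cons_le_cons _ (Multiset.le_cons_self _ _)
  | .notC h, σ, w => fun hw => hw.antitone (h.force σ)
  | .andL h, σ, w => fun hw => ⟨h.force σ w hw.1, hw.2⟩
  | .andR h, σ, w => fun hw => ⟨hw.1, h.force σ w hw.2⟩
  | .orL h, σ, w => fun hw => hw.antitone fun _ hv => ⟨hv.1.antitone (h.force σ), hv.2⟩
  | .orR h, σ, w => fun hw => hw.antitone fun _ hv => ⟨hv.1, hv.2.antitone (h.force σ)⟩
  | .impL h, σ, w => fun hw => hw.antitone fun v hv => ⟨h.force σ v hv.1, hv.2⟩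
  | .impR h, σ, w => fun hw => hw.antitone fun _ hv => ⟨hv.1, hv.2.antitone (h.force σ)⟩
  | .allC h, σ, w => fun hw t => h.force _ w (hw t)
  | .exC h, σ, w => fun hw => hw.antitone fun _ hv t => (hv t).antitone (h.force _)
theorem RwPos.force {rs : PRS L} {A B : Form (withEq L)} :
    RwPos rs.toEq A B → ∀ (σ : (s : L.Sorts) → ℕ → Term L s) (w : Ctx L),
      Form.force rs σ B w → Form.force rs σ A w
  | .predArg p args args' i h hj, σ, w =>
      Form.force_pred_congr fun j => (Form.force_predArg h hj σ j).symm
  | .rule τ h, σ, w => by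
      obtain ⟨P₀, A₀, h, rfl, rfl⟩ := h
      refine fun hw => (Form.force_subst_toEq rs σ τ P₀ w).mpr ?_
      exact ((Form.force_subst_toEq rs σ τ A₀ w).mp hw).of_rwPosS (.single (.rule _ h))
  | .notC h, σ, w => fun hw => hw.antitone (h.force σ)
  | .andL h, σ, w => fun hw => ⟨h.force σ w hw.1, hw.2⟩
  | .andR h, σ, w => fun hw => ⟨hw.1, h.force σ w hw.2⟩
  | .orL h, σ, w => fun hw => hw.antitone fun _ hv => ⟨hv.1.antitone (h.force σ), hv.2⟩
  | .orR h, σ, w => fun hw => hw.antitone fun _ hv => ⟨hv.1, hv.2.antitone (h.force σ)⟩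
  | .impL h, σ, w => fun hw => hw.antitone fun v hv => ⟨h.force σ v hv.1, hv.2⟩
  | .impR h, σ, w => fun hw => hw.antitone fun _ hv => ⟨hv.1, hv.2.antitone (h.force σ)⟩
  | .allC h, σ, w => fun hw t => h.force _ w (hw t)
  | .exC h, σ, w => fun hw => hw.antitone fun _ hv t => (hv t).antitone (h.force _)
end

theorem RwNegS.force {rs : PRS L} {A B : Form (withEq L)} (h : RwNegS rs.toEq A B)
    {σ : (s : L.Sorts) → ℕ → Term L s} {w : Ctx L} (hw : Form.force rs σ A w) :
    Form.force rs σ B w := by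
  induction h with
  | refl => exact hw
  | tail _ h ih => exact h.force σ w ih

theorem RwPosS.force {rs : PRS L} {A B : Form (withEq L)} (h : RwPosS rs.toEq A B)
    {σ : (s : L.Sorts) → ℕ → Term L s} {w : Ctx L} (hw : Form.force rs σ B w) :
    Form.force rs σ A w := by
  induction h with
  | refl => exact hw
  | tail _ h ih => exact ih (h.force σ w hw)

theorem RwPosS.ctxNeg_force {rs : PRS L} {A B : Form (withEq L)} (h : RwPosS rs.toEq A B)
    {σ : (s : L.Sorts) → ℕ → Term L s} {w : Ctx L} (hw : ctxNeg rs (Form.force rs σ A) w) :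
    ctxNeg rs (Form.force rs σ B) w :=
  hw.antitone fun _ hv => h.force hv

theorem Pf.provable_of_force {rs : PRS L} {n : ℕ} {Γ Δ : Multiset (Form (withEq L))}
    (h : Pf rs.toEq true n Γ Δ) (σ : (s : L.Sorts) → ℕ → Term L s) (w : Ctx L)
    (hΓ : ∀ A ∈ Γ, Form.force rs σ A w) (hΔ : ∀ B ∈ Δ, ctxNeg rs (Form.force rs σ B) w) :
    Provable rs w.1 w.2 := by
  have up : ∀ {σ : (s : L.Sorts) → ℕ → Term L s} {Γ : Multiset (Form (withEq L))} {w v : Ctx L},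
      w ≤ v → (∀ A ∈ Γ, Form.force rs σ A w) → ∀ A ∈ Γ, Form.force rs σ A v :=
    fun hv h A hA => (Form.isRegular_force rs A _).mono hv (h A hA)
  have upN : ∀ {σ : (s : L.Sorts) → ℕ → Term L s} {Δ : Multiset (Form (withEq L))} {w v : Ctx L},
      w ≤ v → (∀ B ∈ Δ, ctxNeg rs (Form.force rs σ B) w) →
        ∀ B ∈ Δ, ctxNeg rs (Form.force rs σ B) v :=
    fun hv h B hB => (h B hB).mono hv
  have shiftL : ∀ {σ : (s : L.Sorts) → ℕ → Term L s} {Γ : Multiset (Form (withEq L))} {w : Ctx L}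
      {s : L.Sorts} (t : Term L s), (∀ A ∈ Γ, Form.force rs σ A w) →
        ∀ A ∈ Γ.map (Form.shift (L := withEq L) s), Form.force rs (pushSubst σ t) A w := by
    intro σ Γ w s t h A hA
    obtain ⟨B, hB, rfl⟩ := Multiset.mem_map.mp hA
    exact (congrFun (Form.force_shift rs σ t B) w).mpr (h B hB)
  have shiftR : ∀ {σ : (s : L.Sorts) → ℕ → Term L s} {Δ : Multiset (Form (withEq L))} {w : Ctx L}
      {s : L.Sorts} (t : Term L s), (∀ B ∈ Δ, ctxNeg rs (Form.force rs σ B) w) →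
        ∀ B ∈ Δ.map (Form.shift (L := withEq L) s),
          ctxNeg rs (Form.force rs (pushSubst σ t) B) w := by
    intro σ Δ w s t h A hA
    obtain ⟨B, hB, rfl⟩ := Multiset.mem_map.mp hA
    exact (congrArg (ctxNeg rs · w) (Form.force_shift rs σ t B)).mpr (h B hB)
  induction h generalizing σ w with
  | @ax A B _ _ h₁ h₂ =>
    exact hΔ B (by simp) w le_rfl (h₂.force (h₁.force (hΓ A (by simp))))
  | cut _ h₁ h₂ _ _ ih₁ ih₂ =>
    refine ih₂ σ w hΓ (Multiset.forall_mem_cons.mpr ⟨fun v hv hC => ?_, hΔ⟩)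
    exact ih₁ σ v (Multiset.forall_mem_cons.mpr ⟨h₁.force (h₂.force hC), up hv hΓ⟩) (upN hv hΔ)
  | contrL h₁ h₂ _ ih =>
    obtain ⟨hA, hΓ⟩ := Multiset.forall_mem_cons.mp hΓ
    refine ih σ w ?_ hΔ
    simp only [Multiset.forall_mem_cons]
    exact ⟨h₁.force hA, h₂.force hA, hΓ⟩
  | contrR h₁ h₂ _ ih =>
    obtain ⟨hA, hΔ⟩ := Multiset.forall_mem_cons.mp hΔ
    refine ih σ w hΓ ?_
    simp only [Multiset.forall_mem_cons]
    exact ⟨h₁.ctxNeg_force hA, h₂.ctxNeg_force hA, hΔ⟩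
  | weakL _ ih => exact ih σ w (Multiset.forall_mem_cons.mp hΓ).2 hΔ
  | weakR _ ih => exact ih σ w hΓ (Multiset.forall_mem_cons.mp hΔ).2
  | topR h => exact hΔ _ (Multiset.mem_cons_self _ _) w le_rfl (h.force trivial)
  | botL h => exact h.force (hΓ _ (Multiset.mem_cons_self _ _))
  | notL h _ ih =>
    obtain ⟨hA, hΓ⟩ := Multiset.forall_mem_cons.mp hΓ
    exact ih σ w hΓ (Multiset.forall_mem_cons.mpr ⟨h.force hA, hΔ⟩)
  | notR h _ ih =>
    obtain ⟨hA, hΔ⟩ := Multiset.forall_mem_cons.mp hΔ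
    exact hA w le_rfl (h.force fun v hv hB =>
      ih σ v (Multiset.forall_mem_cons.mpr ⟨hB, up hv hΓ⟩) (upN hv hΔ))
  | andL h _ ih =>
    obtain ⟨hA, hΓ⟩ := Multiset.forall_mem_cons.mp hΓ
    have hA := h.force hA
    refine ih σ w ?_ hΔ
    simp only [Multiset.forall_mem_cons]
    exact ⟨hA.1, hA.2, hΓ⟩
  | @andR _ _ _ B _ _ _ h _ _ ih₁ ih₂ =>
    obtain ⟨hA, hΔ⟩ := Multiset.forall_mem_cons.mp hΔ
    refine ih₁ σ w hΓ (Multiset.forall_mem_cons.mpr ⟨fun v hv hB => ?_, hΔ⟩)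
    refine ih₂ σ v (up hv hΓ) (Multiset.forall_mem_cons.mpr ⟨fun u hu hC => ?_, upN hv hΔ⟩)
    exact hA u (hv.trans hu) (h.force ⟨(Form.isRegular_force rs B σ).mono hu hB, hC⟩)
  | orL h _ _ ih₁ ih₂ =>
    obtain ⟨hA, hΓ⟩ := Multiset.forall_mem_cons.mp hΓ
    refine h.force hA w le_rfl ⟨fun v hv hB => ?_, fun v hv hC => ?_⟩
    · exact ih₁ σ v (Multiset.forall_mem_cons.mpr ⟨hB, up hv hΓ⟩) (upN hv hΔ)
    · exact ih₂ σ v (Multiset.forall_mem_cons.mpr ⟨hC, up hv hΓ⟩) (upN hv hΔ)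
  | orR h _ ih =>
    obtain ⟨hA, hΔ⟩ := Multiset.forall_mem_cons.mp hΔ
    refine hA w le_rfl (h.force fun v hv hn => ih σ v (up hv hΓ) ?_)
    simp only [Multiset.forall_mem_cons]
    exact ⟨hn.1, hn.2, upN hv hΔ⟩
  | impL h _ _ ih₁ ih₂ =>
    obtain ⟨hA, hΓ⟩ := Multiset.forall_mem_cons.mp hΓ
    refine ih₁ σ w hΓ (Multiset.forall_mem_cons.mpr ⟨fun v hv hB => ?_, hΔ⟩)
    refine h.force hA v hv ⟨hB, fun u hu hC => ?_⟩
    exact ih₂ σ u (Multiset.forall_mem_cons.mpr ⟨hC, up (hv.trans hu) hΓ⟩)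
      (upN (hv.trans hu) hΔ)
  | impR h _ ih =>
    obtain ⟨hA, hΔ⟩ := Multiset.forall_mem_cons.mp hΔ
    exact hA w le_rfl (h.force fun v hv hn =>
      ih σ v (Multiset.forall_mem_cons.mpr ⟨hn.1, up hv hΓ⟩)
        (Multiset.forall_mem_cons.mpr ⟨hn.2, upN hv hΔ⟩))
  | @allL _ _ _ t _ B _ _ h₁ h₂ _ ih =>
    obtain ⟨hA, hΓ⟩ := Multiset.forall_mem_cons.mp hΓ
    refine ih σ w (Multiset.forall_mem_cons.mpr ⟨h₂.force ?_, hΓ⟩) hΔ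
    exact (congrFun (Form.force_inst rs σ t B) w).mpr (h₁.force hA _)
  | @allR _ _ _ _ B _ h _ ih =>
    obtain ⟨hA, hΔ⟩ := Multiset.forall_mem_cons.mp hΔ
    refine hA w le_rfl (h.force fun t => (Form.isRegular_force rs B _).of_neg_neg fun v hv hn => ?_)
    exact ih (pushSubst σ t) v (shiftL t (up hv hΓ))
      (Multiset.forall_mem_cons.mpr ⟨hn, shiftR t (upN hv hΔ)⟩)
  | exL h _ ih =>
    obtain ⟨hA, hΓ⟩ := Multiset.forall_mem_cons.mp hΓ
    refine h.force hA w le_rfl fun t v hv hB => ?_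
    exact ih (pushSubst σ t) v (Multiset.forall_mem_cons.mpr ⟨hB, shiftL t (up hv hΓ)⟩)
      (shiftR t (upN hv hΔ))
  | @exR _ _ _ t _ B _ _ h₁ h₂ _ ih =>
    obtain ⟨hA, hΔ⟩ := Multiset.forall_mem_cons.mp hΔ
    refine hA w le_rfl (h₁.force fun v hv hn => ?_)
    refine ih σ v (up hv hΓ) (Multiset.forall_mem_cons.mpr ⟨fun u hu hC => ?_, upN hv hΔ⟩)
    exact hn (Term.evalEq (L := L) σ _ t) u hu
      ((congrFun (Form.force_inst rs σ t B) u).mp (h₂.force hC))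

theorem Form.force_univClosure {rs : PRS L} {A : Form (withEq L)}
    (h : ∀ (σ : (s : L.Sorts) → ℕ → Term L s) (w : Ctx L), Form.force rs σ A w)
    (σ : (s : L.Sorts) → ℕ → Term L s) (w : Ctx L) : Form.force rs σ (univClosure A) w := by
  have key : ∀ (n : ℕ) (A : Form (withEq L)),
      (∀ (σ : (s : L.Sorts) → ℕ → Term L s) (w : Ctx L), Form.force rs σ A w) →
        Form.force rs σ (closeSteps n A) w := by
    intro n
    induction n with
    | zero => exact fun A h => h σ w
    | succ n ih =>
      intro A h
      rw [closeSteps]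
      split
      · exact h σ w
      · exact ih _ fun σ w t => (congrFun (Form.force_subst rs _ _ A) w).mpr (h _ w)
  exact key _ A h

theorem Form.force_imp {rs : PRS L} {A B : Form (withEq L)}
    {σ : (s : L.Sorts) → ℕ → Term L s} {w : Ctx L}
    (h : ∀ v, Form.force rs σ A v → Form.force rs σ B v) : Form.force rs σ (.imp A B) w :=
  fun v _ hv => hv.2 v le_rfl (h v hv.1)

theorem Form.forall_eqE_or_provable_of_force {rs : PRS L} {l : List L.Sorts}
    {σ : (s : L.Sorts) → ℕ → Term L s} {w : Ctx L}
    (h : Form.force rs σ ((List.finRange l.length).foldr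
      (fun i C => .and (eqForm (s := l.get i) (.var (2 * i.val)) (.var (2 * i.val + 1))) C) .top)
      w) (i : Fin l.length) :
    EqE rs (l.get i) (σ _ (2 * i.val)) (σ _ (2 * i.val + 1)) ∨ Provable rs w.1 w.2 := by
  have key : ∀ l' : List (Fin l.length), Form.force rs σ (l'.foldr
      (fun i C => .and (eqForm (s := l.get i) (.var (2 * i.val)) (.var (2 * i.val + 1))) C) .top)
      w → ∀ i ∈ l', EqE rs (l.get i) (σ _ (2 * i.val)) (σ _ (2 * i.val + 1)) ∨
        Provable rs w.1 w.2 := by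
    intro l'
    induction l' with
    | nil => simp
    | cons i l' ih =>
      intro h j hj
      rcases List.mem_cons.mp hj with rfl | hj
      · exact h.1
      · exact ih h.2 j hj
  exact key _ h i (List.mem_finRange i)

theorem Form.force_eqAxioms {rs : PRS L} {C : Form (withEq L)} (hC : C ∈ EqAxioms L)
    (σ : (s : L.Sorts) → ℕ → Term L s) (w : Ctx L) : Form.force rs σ C w := by
  rcases hC with (((⟨s, rfl⟩ | ⟨s, rfl⟩) | ⟨s, rfl⟩) | ⟨f, rfl⟩) | ⟨p, rfl⟩ <;>
    refine Form.force_univClosure (fun σ w => ?_) σ w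
  · exact Or.inl (.refl _)
  · exact Form.force_imp fun v => Or.imp_left EqE.symm
  · refine Form.force_imp fun v hv => ?_
    rcases hv with ⟨h₁ | h₁, h₂ | h₂⟩
    · exact Or.inl (h₁.trans h₂)
    all_goals exact Or.inr ‹_›
  · refine Form.force_imp fun v hv => ?_
    by_cases hp : Provable rs v.1 v.2
    · exact Or.inr hp
    · exact Or.inl (EqE.congr (rs := rs) f fun i =>
        (Form.forall_eqE_or_provable_of_force hv i).resolve_right hp)
  · refine Form.force_imp fun v hv u hu hn => ?_
    by_cases hp : Provable rs u.1 u.2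
    · exact hp
    · have hu := (Form.isRegular_force rs (congrHypP p) σ).mono hu hv
      exact hn.2 u le_rfl (Form.force_pred_congr (fun i =>
        (Form.forall_eqE_or_provable_of_force (L := L) hu i).resolve_right hp) hn.1)

/-- Adding equality is conservative: a sequent `Γ ⊢ Δ` of the
language `L` is provable modulo `R` if and only if it is provable in the
axioms of equality of `L' = withEq L` modulo `R`. -/
theorem withEq_conservative (L : Language) (rs : PRS L)
    (Γ Δ : Multiset (Form L)) :
    Provable rs Γ Δ ↔
      ProvableIn rs.toEq (EqAxioms L) (Γ.map Form.toEq) (Δ.map Form.toEq) := by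
  refine ⟨fun h => ⟨0, by simp, by rw [add_zero]; exact h.toEq⟩, ?_⟩
  rintro ⟨T', hT', n, h⟩
  refine h.provable_of_force (fun _ n => .var n) (Γ, Δ) (fun C hC => ?_) fun C hC => ?_
  · rcases Multiset.mem_add.mp hC with hC | hC
    · obtain ⟨A, hA, rfl⟩ := Multiset.mem_map.mp hC
      rw [Form.force_toEq, Form.subst_var]
      exact Provable.identity hA (Multiset.mem_cons_self _ _)
    · exact Form.force_eqAxioms (hT' C hC) _ _
  · obtain ⟨A, hA, rfl⟩ := Multiset.mem_map.mp hC
    rw [Form.force_toEq, Form.subst_var, ctxNeg_provable_cons]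
    exact Provable.identity (Multiset.mem_cons_self _ _) hA

end
end PDM
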